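/- arXiv:1206.1613 — 2 statements merged into one kernel-verified Lean document; each statement's English description precedes it below -/
import Mathlib

section
/- For every R > 0, A(R) = Σ_{n ∈ ℤ², n ≠ 0} (1/(π‖n‖²)) J₂(‖n‖√R), where the series on the right converges absolutely. -/
open Real MeasureTheory

/-- The Bessel function `J_m` for a nonnegative integer `m`. -/
noncomputable def besselJ (m : ℕ) (x : ℝ) : ℝ :=
  (1 / π) * ∫ θ in (0:ℝ)..π, Real.cos (m * θ - x * Real.sin θ)

/-- The Euclidean norm of a lattice point `n ∈ ℤ²`. -/
noncomputable def znorm (n : ℤ × ℤ) : ℝ :=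
  Real.sqrt ((n.1 : ℝ) ^ 2 + (n.2 : ℝ) ^ 2)

/-- `N(t)`: number of lattice points in the closed disk of radius `√t/(2π)`. -/
noncomputable def Nlat (t : ℝ) : ℕ :=
  Set.ncard {n : ℤ × ℤ | znorm n ≤ Real.sqrt t / (2 * π)}

/-- `D(t) = N(t) − t/(4π)`. -/
noncomputable def Dlat (t : ℝ) : ℝ := (Nlat t : ℝ) - t / (4 * π)

/-- `A(R) = (1/R) ∫₀^R D(t) dt`. -/
noncomputable def Alat (R : ℝ) : ℝ := (1 / R) * ∫ t in (0:ℝ)..R, Dlat t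

/-- Two integrations by parts for the Poisson-type integral of the Bessel function. -/
theorem bessel_parts (z : ℝ) :
    (z:ℂ)^2 * ∫ φ in (-(π/2))..(π/2), ((Real.cos φ)^4:ℂ) * Complex.exp (-Complex.I * z * Real.sin φ)
     = 3 * ∫ φ in (-(π/2))..(π/2), (Real.cos (2*φ):ℂ) * Complex.exp (-Complex.I * z * Real.sin φ) := by
  set c : ℂ := -Complex.I * z with hc
  have hc2 : c^2 = -(z:ℂ)^2 := by rw [hc, mul_pow]; simp
  have key := intervalIntegral.integral_eq_sub_of_hasDerivAt (a := -(π/2)) (b := π/2)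
    (f := fun φ : ℝ => (-c * (Real.cos φ:ℂ)^3 - 3 * Real.cos φ * Real.sin φ) * Complex.exp (c * Real.sin φ))
    (f' := fun φ : ℝ => (z:ℂ)^2 * (((Real.cos φ)^4:ℂ) * Complex.exp (c * Real.sin φ))
      - 3 * ((Real.cos (2*φ):ℂ) * Complex.exp (c * Real.sin φ))) ?_ ?_
  · simp only [Real.cos_neg, Real.cos_pi_div_two] at key
    rw [intervalIntegral.integral_sub, intervalIntegral.integral_const_mul,
      intervalIntegral.integral_const_mul] at key
    · simp at key ⊢
      linear_combination key
    · apply Continuous.intervalIntegrable; fun_prop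
    · apply Continuous.intervalIntegrable; fun_prop
  · intro φ _
    have h1 := (Real.hasDerivAt_cos φ).ofReal_comp
    have h2 := (Real.hasDerivAt_sin φ).ofReal_comp
    have h3 := (h2.const_mul c).cexp
    have h4 := ((((h1.pow 3).const_mul (-c)).sub ((h1.const_mul 3).mul h2)).mul h3)
    refine h4.congr_deriv ?_
    have : (Real.cos (2*φ) : ℂ) = (Real.cos φ:ℂ)^2 - (Real.sin φ:ℂ)^2 := by
      rw [Real.cos_two_mul']; push_cast; ring
    rw [this]
    simp only [Pi.pow_apply, Pi.sub_apply, Pi.mul_apply]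
    push_cast
    have : (z:ℂ)^2 = -c^2 := by rw [hc2]; ring
    rw [this]
    simp
    ring
  · apply Continuous.intervalIntegrable; fun_prop

theorem odd_int (a : ℝ) (f : ℝ → ℝ) (hf : ∀ x, f (-x) = - f x) : ∫ x in (-a)..a, f x = 0 := by
  have := intervalIntegral.integral_comp_neg (a := -a) (b := a) f
  simp only [hf, intervalIntegral.integral_neg, neg_neg] at this
  linarith

theorem bessel_sym (z : ℝ) :
    ∫ φ in (-(π/2))..(π/2), (Real.cos (2*φ):ℂ) * Complex.exp (-Complex.I * z * Real.sin φ)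
     = ((∫ φ in (-(π/2))..(π/2), Real.cos (2*φ) * Real.cos (z * Real.sin φ) : ℝ) : ℂ) := by
  have h : ∀ φ : ℝ, (Real.cos (2*φ):ℂ) * Complex.exp (-Complex.I * z * Real.sin φ)
     = ((Real.cos (2*φ) * Real.cos (z * Real.sin φ) : ℝ) : ℂ) - Complex.I * ((Real.cos (2*φ) * Real.sin (z * Real.sin φ) : ℝ) : ℂ) := by
    intro φ
    have : -Complex.I * z * Real.sin φ = ((-(z * Real.sin φ) : ℝ) : ℂ) * Complex.I := by push_cast; ring
    rw [this, Complex.exp_mul_I, ← Complex.ofReal_cos, ← Complex.ofReal_sin, Real.cos_neg, Real.sin_neg]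
    push_cast; ring
  simp_rw [h]
  rw [intervalIntegral.integral_sub, intervalIntegral.integral_const_mul, intervalIntegral.integral_ofReal,
    intervalIntegral.integral_ofReal, odd_int _ (fun φ => Real.cos (2*φ) * Real.sin (z * Real.sin φ))]
  · simp
  · intro x; simp
  · apply Continuous.intervalIntegrable; fun_prop
  · apply Continuous.intervalIntegrable; fun_prop

theorem bessel_half (z : ℝ) (hz : z ≠ 0) :
    ∫ θ in (0:ℝ)..π, Real.cos ((2:ℕ) * θ - z * Real.sin θ) =
      ∫ φ in (-(π/2))..(π/2), Real.cos (2*φ) * Real.cos (z * Real.sin φ) := by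
  have hper : Function.Periodic (fun φ => Real.cos (2*φ) * Real.cos (z * Real.sin φ)) π := by
    intro x
    simp [mul_add, Real.sin_add_pi]
  have h1 := hper.intervalIntegral_add_eq (-(π/2)) 0
  rw [zero_add, show -(π/2) + π = π/2 by ring] at h1
  rw [h1]
  have h : ∀ θ : ℝ, Real.cos ((2:ℕ) * θ - z * Real.sin θ) = Real.cos (2*θ) * Real.cos (z * Real.sin θ) + Real.sin (2*θ) * Real.sin (z * Real.sin θ) := by
    intro θ; rw [Real.cos_sub]; norm_num
  simp_rw [h]
  rw [intervalIntegral.integral_add]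
  · have key := intervalIntegral.integral_eq_sub_of_hasDerivAt (a := 0) (b := π)
      (f := fun φ : ℝ => -2 * Real.sin φ * Real.cos (z * Real.sin φ) / z + 2 * Real.sin (z * Real.sin φ) / z ^2)
      (f' := fun φ : ℝ => Real.sin (2*φ) * Real.sin (z * Real.sin φ)) ?_ ?_
    · rw [key]; simp
    · intro φ _
      have h2 := (Real.hasDerivAt_sin φ)
      have h3 := (h2.const_mul z).cos
      have h4 := (h2.const_mul z).sin
      refine ((((h2.const_mul (-2)).mul h3).div_const z).add ((h4.const_mul 2).div_const (z^2))).congr_deriv ?_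
      rw [Real.sin_two_mul]
      field_simp
      ring
    · apply Continuous.intervalIntegrable; fun_prop
  · apply Continuous.intervalIntegrable; fun_prop
  · apply Continuous.intervalIntegrable; fun_prop
theorem bessel_bound (z : ℝ) (hz : 1 ≤ z) :
    |∫ φ in (-(π/2))..(π/2), Real.cos (2*φ) * Real.cos (z * Real.sin φ)| ≤ 50 * z ^ (-(1/3):ℝ) := by
  have hz0 : 0 < z := by linarith
  obtain ⟨δ, hδdef⟩ : ∃ δ, δ = z ^ (-(1/3):ℝ) := ⟨_, rfl⟩
  rw [← hδdef]
  have hδ0 : 0 < δ := by rw [hδdef]; positivity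
  have hδ1 : δ ≤ 1 := by rw [hδdef]; exact Real.rpow_le_one_of_one_le_of_nonpos hz (by norm_num)
  have hδz : δ ^ 3 * z = 1 := by
    rw [hδdef, ← Real.rpow_natCast, ← Real.rpow_mul hz0.le]
    norm_num
    rw [Real.rpow_neg_one]; field_simp
  have hpi := Real.pi_gt_three
  have hpi4 := Real.pi_lt_d2
  set b := π/2 - δ with hb
  have hb0 : 0 < b := by linarith
  set q := Real.cos b with hq
  have hqs : q = Real.sin δ := by rw [hq, hb, Real.cos_pi_div_two_sub]
  have hqδ : 2/π * δ ≤ q := by rw [hqs]; exact Real.mul_le_sin hδ0.le (by linarith)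
  have hq0 : 0 < q := lt_of_lt_of_le (by positivity) hqδ
  have hq1 : q ≤ 1 := Real.cos_le_one _
  have hcos : ∀ θ ∈ Set.uIcc (-b) b, q ≤ Real.cos θ := by
    intro θ hθ
    rw [Set.uIcc_of_le (by linarith)] at hθ
    rw [← Real.cos_abs θ]
    exact Real.cos_le_cos_of_nonneg_of_le_pi (abs_nonneg _) (by linarith) (abs_le.2 hθ)
  have hcont : Continuous (fun φ => Real.cos (2*φ) * Real.cos (z * Real.sin φ)) := by fun_prop
  have hi : ∀ a c, IntervalIntegrable (fun φ => Real.cos (2*φ) * Real.cos (z * Real.sin φ)) volume a c :=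
    fun a c => hcont.intervalIntegrable a c
  have hle1 : ∀ φ, |Real.cos (2*φ) * Real.cos (z * Real.sin φ)| ≤ 1 := by
    intro φ; rw [abs_mul]
    exact mul_le_one₀ (Real.abs_cos_le_one _) (abs_nonneg _) (Real.abs_cos_le_one _)
  have hc2 : ContinuousOn (fun φ : ℝ => Real.sin (z * Real.sin φ) * (-2 * Real.sin φ - Real.sin φ / Real.cos φ ^2) / z) (Set.uIcc (-b) b) := by
    have : ∀ θ ∈ Set.uIcc (-b) b, Real.cos θ ^ 2 ≠ 0 := fun θ hθ => by
      have := hcos θ hθ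
      have : 0 < Real.cos θ := by linarith
      positivity
    fun_prop (disch := assumption)
  have key := intervalIntegral.integral_eq_sub_of_hasDerivAt (a := -b) (b := b)
    (f := fun φ : ℝ => Real.sin (z * Real.sin φ) * (2 * Real.cos φ - 1 / Real.cos φ) / z)
    (f' := fun φ : ℝ => Real.cos (2*φ) * Real.cos (z * Real.sin φ) +
      Real.sin (z * Real.sin φ) * (-2 * Real.sin φ - Real.sin φ / Real.cos φ ^2) / z) ?_ ?_
  rotate_left
  · intro φ hφ
    have h0 : Real.cos φ ≠ 0 := by have := hcos φ hφ; linarith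
    have h1 := Real.hasDerivAt_cos φ
    have h2 := Real.hasDerivAt_sin φ
    have h4 := (h2.const_mul z).sin
    refine ((h4.mul ((h1.const_mul 2).sub ((hasDerivAt_const φ (1:ℝ)).div h1 h0))).div_const z).congr_deriv ?_
    rw [Real.cos_two_mul]
    simp only [Pi.sub_apply, Pi.div_apply]
    field_simp
    ring
  · exact (hcont.continuousOn.add hc2).intervalIntegrable
  rw [intervalIntegral.integral_add (hi _ _) hc2.intervalIntegrable] at key
  have hB : ∀ θ ∈ Set.uIcc (-b) b, |Real.sin (z * Real.sin θ) * (2 * Real.cos θ - 1 / Real.cos θ) / z| ≤ 3/q^2/z := by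
    intro θ hθ
    have h0 := hcos θ hθ
    have h00 : 0 < Real.cos θ := by linarith
    rw [abs_div, abs_of_pos hz0, abs_mul]
    gcongr
    have e1 : |2 * Real.cos θ - 1 / Real.cos θ| ≤ 3/q^2 := by
      have e2 : 1 / Real.cos θ ≤ 1/q := by gcongr
      have e3 : 1/q ≤ 1/q^2 := by gcongr; nlinarith
      have e4 : 1 ≤ 1/q^2 := by rw [le_div_iff₀ (by positivity)]; nlinarith
      have e5 : 0 < 1 / Real.cos θ := by positivity
      have e6 := Real.cos_le_one θ
      have e7 : 3/q^2 = 3 * (1/q^2) := by ring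
      rw [abs_le]; constructor <;> linarith
    calc _ ≤ 1 * (3/q^2) := by
          gcongr; exact Real.abs_sin_le_one _
      _ = _ := one_mul _
  have hC : ‖∫ φ in (-b)..b, Real.sin (z * Real.sin φ) * (-2 * Real.sin φ - Real.sin φ / Real.cos φ ^2) / z‖ ≤ 3/q^2/z * |b - -b| := by
    apply intervalIntegral.norm_integral_le_of_norm_le_const
    intro θ hθ
    have h0 := hcos θ (Set.uIoc_subset_uIcc hθ)
    have h00 : 0 < Real.cos θ := by linarith
    rw [Real.norm_eq_abs, abs_div, abs_of_pos hz0, abs_mul]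
    gcongr
    have e1 : |-2 * Real.sin θ - Real.sin θ / Real.cos θ ^2| ≤ 3/q^2 := by
      have e2 : 1 / Real.cos θ^2 ≤ 1/q^2 := by gcongr
      have e4 : 1 ≤ 1/q^2 := by rw [le_div_iff₀ (by positivity)]; nlinarith
      have e5 : 0 < 1 / Real.cos θ^2 := by positivity
      have e7 : 3/q^2 = 3 * (1/q^2) := by ring
      have : -2 * Real.sin θ - Real.sin θ / Real.cos θ ^2 = -(Real.sin θ * (2 + 1/Real.cos θ^2)) := by ring
      rw [this, abs_neg, abs_mul, abs_of_pos (by positivity : 0 < 2 + 1/Real.cos θ^2)]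
      calc _ ≤ 1 * (2 + 1/Real.cos θ^2) := by gcongr; exact Real.abs_sin_le_one _
        _ ≤ _ := by linarith
    calc _ ≤ 1 * (3/q^2) := by
          gcongr; exact Real.abs_sin_le_one _
      _ = _ := one_mul _
  have hL : ‖∫ φ in (-(π/2))..(-b), Real.cos (2*φ) * Real.cos (z * Real.sin φ)‖ ≤ 1 * |-b - -(π/2)| :=
    intervalIntegral.norm_integral_le_of_norm_le_const fun θ _ => hle1 θ
  have hR : ‖∫ φ in b..(π/2), Real.cos (2*φ) * Real.cos (z * Real.sin φ)‖ ≤ 1 * |π/2 - b| :=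
    intervalIntegral.norm_integral_le_of_norm_le_const fun θ _ => hle1 θ
  rw [← intervalIntegral.integral_add_adjacent_intervals (hi _ (-b)) (hi (-b) _),
    ← intervalIntegral.integral_add_adjacent_intervals (hi (-b) b) (hi b (π/2))]
  have h1 := hB b (Set.right_mem_uIcc)
  have h2 := hB (-b) (Set.left_mem_uIcc)
  rw [show -b - -(π/2) = δ by rw [hb]; ring, abs_of_pos hδ0, Real.norm_eq_abs] at hL
  rw [show π/2 - b = δ by rw [hb]; ring, abs_of_pos hδ0, Real.norm_eq_abs] at hR
  rw [show b - -b = 2*b by ring, abs_of_pos (by linarith), Real.norm_eq_abs] at hC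
  have hX : 3/q^2/z ≤ 8 * δ := by
    rw [div_div, div_le_iff₀ (by positivity)]
    have : 3 * δ^2 ≤ 8 * q^2 := by
      have h9 : 2 * δ ≤ π * q := by
        have := mul_le_mul_of_nonneg_left hqδ Real.pi_pos.le
        have e : π * (2/π*δ) = 2 * δ := by field_simp
        linarith
      have : 2 * δ ≤ 3.15 * q := by nlinarith
      nlinarith
    have h8 : 0 < δ * z := by positivity
    nlinarith [mul_le_mul_of_nonneg_left this h8.le]
  have h3 : 3/q^2/z * (2*b) ≤ 8 * δ * 3.15 := by
    gcongr; linarith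
  rw [abs_le] at *
  constructor <;> linarith [h1.1,h1.2,h2.1,h2.2,hL.1,hL.2,hR.1,hR.2,hC.1,hC.2]
noncomputable def Fd (ρ x y : ℝ) : ℝ := max (ρ^2 - x^2 - y^2) 0

noncomputable def Hd (ρ k y : ℝ) : ℂ := ∫ x : ℝ, Complex.exp (↑(-2 * π * x * k) * Complex.I) * (Fd ρ x y : ℂ)
noncomputable def Pd (ρ k l : ℝ) : ℂ := ∫ y : ℝ, Complex.exp (↑(-2 * π * y * l) * Complex.I) * Hd ρ k y

theorem Fd_cont (ρ : ℝ) : Continuous (fun p : ℝ × ℝ => Fd ρ p.1 p.2) := by unfold Fd; fun_prop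

theorem Fd_zero_left {ρ x y : ℝ} (hρ : 0 < ρ) (h : ρ ≤ |x|) : Fd ρ x y = 0 := by
  unfold Fd
  apply max_eq_right
  have : ρ^2 ≤ x^2 := by rw [← sq_abs x]; gcongr
  nlinarith [sq_nonneg y]
theorem Fd_zero_right {ρ x y : ℝ} (hρ : 0 < ρ) (h : ρ ≤ |y|) : Fd ρ x y = 0 := by
  unfold Fd
  apply max_eq_right
  have : ρ^2 ≤ y^2 := by rw [← sq_abs y]; gcongr
  nlinarith [sq_nonneg x]

theorem Hd_zero {ρ k y : ℝ} (hρ : 0 < ρ) (h : ρ ≤ |y|) : Hd ρ k y = 0 := by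
  unfold Hd; simp [Fd_zero_right hρ h]

theorem whole_to_Icc {ρ : ℝ} (hρ : 0 ≤ ρ) (f : ℝ → ℂ) (h : ∀ x, ρ ≤ |x| → f x = 0) :
    ∫ x, f x = ∫ x in (-ρ)..ρ, f x := by
  rw [intervalIntegral.integral_of_le (by linarith)]
  symm
  apply setIntegral_eq_integral_of_forall_compl_eq_zero
  intro x hx
  apply h
  by_contra hc
  push Not at hc
  rw [abs_lt] at hc
  exact hx ⟨hc.1, hc.2.le⟩

theorem Hd_cont {ρ k : ℝ} (hρ : 0 < ρ) : Continuous (Hd ρ k) := by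
  have : Hd ρ k = fun y => ∫ x in Set.Icc (-ρ) ρ, Complex.exp (↑(-2 * π * x * k) * Complex.I) * (Fd ρ x y : ℂ) := by
    funext y
    unfold Hd
    rw [whole_to_Icc hρ.le _ (fun x hx => by simp [Fd_zero_left hρ hx]),
      intervalIntegral.integral_of_le (by linarith), integral_Icc_eq_integral_Ioc]
  rw [this]
  apply continuous_parametric_integral_of_continuous _ isCompact_Icc
  unfold Fd Function.uncurry
  fun_prop

theorem Hd_fourier (ρ k y : ℝ) : Hd ρ k y = FourierTransform.fourier (fun x => (Fd ρ x y : ℂ)) k := by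
  rw [Real.fourier_real_eq_integral_exp_smul]; rfl
theorem Pd_fourier (ρ k y : ℝ) : Pd ρ k y = FourierTransform.fourier (Hd ρ k) y := by
  rw [Real.fourier_real_eq_integral_exp_smul]; rfl

theorem poisson1 {ρ : ℝ} (f : ℝ → ℂ) (hf : Continuous f) (h : ∀ x, ρ ≤ |x| → f x = 0)
    (hs : Summable fun n : ℤ => FourierTransform.fourier f (n:ℝ)) :
    ∑' n : ℤ, f n = ∑' n : ℤ, FourierTransform.fourier f (n:ℝ) := by
  have := Real.tsum_eq_tsum_fourier_of_rpow_decay_of_summable hf (b := 2) (by norm_num) ?_ hs 0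
  · simpa using this
  · apply Asymptotics.IsBigO.of_bound 1
    have : ∀ᶠ x in Filter.cocompact ℝ, ρ ≤ ‖x‖ := tendsto_norm_cocompact_atTop.eventually_ge_atTop ρ
    filter_upwards [this] with x hx
    rw [h x hx]; simp; positivity

theorem quad_exp (s : ℝ) (c : ℂ) (hc : c ≠ 0) :
    ∫ x in (-s)..s, Complex.exp (c * x) * ((s:ℂ)^2 - (x:ℂ)^2) =
      (2 * s / c^2 - 2 / c^3) * Complex.exp (c*s) + (2 * s / c^2 + 2/c^3) * Complex.exp (-c*s) := by
  have key := intervalIntegral.integral_eq_sub_of_hasDerivAt (a := -s) (b := s)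
    (f := fun x : ℝ => Complex.exp (c * x) * (((s:ℂ)^2 - (x:ℂ)^2)/c + 2 * x / c^2 - 2/c^3))
    (f' := fun x : ℝ => Complex.exp (c * x) * ((s:ℂ)^2 - (x:ℂ)^2)) ?_ ?_
  · rw [key]
    push_cast
    rw [mul_neg, ← neg_mul]
    ring
  · intro x _
    have h1 : HasDerivAt (fun x : ℝ => (x:ℂ)) 1 x := Complex.ofRealCLM.hasDerivAt
    refine ((h1.const_mul c).cexp.mul (((((h1.pow 2).const_sub ((s:ℂ)^2)).div_const c).add ((h1.const_mul 2).div_const (c^2))).sub_const (2/c^3))).congr_deriv ?_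
    simp only [Pi.add_apply]
    push_cast
    simp only [Pi.pow_apply]
    field_simp
    ring
  · apply Continuous.intervalIntegrable; fun_prop

theorem Hd_nonpos {ρ k y : ℝ} (h : ρ^2 - y^2 ≤ 0) : Hd ρ k y = 0 := by
  have : ∀ x, Fd ρ x y = 0 := fun x => by
    unfold Fd; apply max_eq_right; nlinarith [sq_nonneg x]
  unfold Hd; simp [this]

theorem Hd_eq {ρ k y s : ℝ} (hs : 0 ≤ s) (h : ρ^2 - y^2 = s^2) :
    Hd ρ k y = ∫ x in (-s)..s, Complex.exp (↑(-2 * π * x * k) * Complex.I) * ((s:ℂ)^2 - (x:ℂ)^2) := by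
  unfold Hd
  have hF : ∀ x, Fd ρ x y = max (s^2 - x^2) 0 := by intro x; unfold Fd; rw [← h]; congr 1; ring
  rw [whole_to_Icc hs]
  · apply intervalIntegral.integral_congr
    intro x hx
    rw [Set.uIcc_of_le (by linarith)] at hx
    simp only [hF]
    rw [max_eq_left]; · push_cast; rfl
    nlinarith [hx.1, hx.2]
  · intro x hx
    rw [hF, max_eq_right]; · simp
    have : s^2 ≤ x^2 := by rw [← sq_abs x]; gcongr
    linarith

theorem Hd_summable {ρ y : ℝ} : Summable (fun k : ℤ => Hd ρ k y) := by
  rcases le_or_gt (ρ^2 - y^2) 0 with h | h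
  · simp only [Hd_nonpos h]; exact summable_zero
  set s := Real.sqrt (ρ^2 - y^2) with hs
  have hs0 : 0 ≤ s := Real.sqrt_nonneg _
  have h2 : ρ^2 - y^2 = s^2 := (Real.sq_sqrt h.le).symm
  have hsum : Summable (fun k : ℤ => (4 * s + 4) * (1 / (k:ℝ)^2)) :=
    (Real.summable_one_div_int_pow.2 (by norm_num)).mul_left _
  apply Summable.of_norm_bounded_eventually hsum
  have : ∀ᶠ k : ℤ in Filter.cofinite, k ≠ 0 := Filter.eventually_cofinite_ne 0
  filter_upwards [this] with k hk
  rw [Hd_eq hs0 h2]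
  set c : ℂ := ((-2*π*k:ℝ):ℂ) * Complex.I with hc
  have hk1 : (1:ℝ) ≤ |(k:ℝ)| := by exact_mod_cast Int.one_le_abs hk
  have hcn : ‖c‖ = 2 * π * |(k:ℝ)| := by
    rw [hc, norm_mul, Complex.norm_real]; simp [abs_of_pos Real.pi_pos]
  have hkc : |(k:ℝ)| ≤ ‖c‖ := by rw [hcn]; nlinarith [Real.pi_gt_three]
  have hc1 : 1 ≤ ‖c‖ := hk1.trans hkc
  have hc0 : c ≠ 0 := by intro h; rw [h] at hc1; simp at hc1; linarith
  have e1 : ∀ x : ℝ, Complex.exp (↑(-2 * π * x * k) * Complex.I) = Complex.exp (c * x) := by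
    intro x; rw [hc]; congr 1; push_cast; ring
  simp_rw [e1]
  rw [quad_exp _ _ hc0]
  have n1 : ‖Complex.exp (c*s)‖ = 1 := by
    rw [← e1]; exact Complex.norm_exp_ofReal_mul_I _
  have n2 : ‖Complex.exp (-c*s)‖ = 1 := by
    have := e1 (-s)
    rw [show -c * s = c * ((-s:ℝ):ℂ) by push_cast; ring, ← this]; exact Complex.norm_exp_ofReal_mul_I _
  have m1 : ‖2 * (s:ℂ) / c^2‖ = 2 * s / ‖c‖^2 := by
    simp [abs_of_nonneg hs0]
  have m2 : ‖2 / c^3‖ ≤ 2 / ‖c‖^2 := by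
    rw [norm_div, norm_pow]; simp only [Complex.norm_ofNat]; gcongr; norm_num
  calc _ ≤ ‖(2 * s / c^2 - 2 / c^3) * Complex.exp (c*s)‖ + ‖(2 * s / c^2 + 2/c^3) * Complex.exp (-c*s)‖ := norm_add_le _ _
    _ = ‖2 * s / c^2 - 2 / c^3‖ + ‖2 * s / c^2 + 2/c^3‖ := by rw [norm_mul, norm_mul, n1, n2]; ring
    _ ≤ (‖2 * s / c^2‖ + ‖2 / c^3‖) + (‖2 * s / c^2‖ + ‖2/c^3‖) := add_le_add (norm_sub_le _ _) (norm_add_le _ _)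
    _ ≤ (4 * s + 4) * (1/‖c‖^2) := by rw [m1]; calc _ ≤ (2 * s / ‖c‖^2 + 2 / ‖c‖^2) + (2 * s / ‖c‖^2 + 2 / ‖c‖^2) := by gcongr
                                         _ = _ := by ring
    _ ≤ _ := by rw [← sq_abs (k:ℝ)]; gcongr

noncomputable def Phi (ρ k l : ℝ) : ℂ :=
  ∫ z : ℂ, Complex.exp (↑(-2 * π * (z.re * k + z.im * l)) * Complex.I) * ((max (ρ^2 - ‖z‖^2) 0 : ℝ) : ℂ)

theorem Pd_eq_Phi {ρ : ℝ} (hρ : 0 < ρ) (k l : ℝ) : Pd ρ k l = Phi ρ k l := by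
  set f : ℝ × ℝ → ℂ := fun p => Complex.exp (↑(-2 * π * (p.1 * k + p.2 * l)) * Complex.I) * (Fd ρ p.1 p.2 : ℂ) with hf
  have hcont : Continuous f := by rw [hf]; unfold Fd; fun_prop
  have hsupp : HasCompactSupport f := by
    apply HasCompactSupport.of_support_subset_isCompact (isCompact_Icc (a := -ρ) (b := ρ) |>.prod (isCompact_Icc (a := -ρ) (b := ρ)))
    intro p hp
    by_contra hc
    apply hp
    simp only [hf]
    by_cases h1 : ρ ≤ |p.1|
    · simp [Fd_zero_left hρ h1]
    · by_cases h2 : ρ ≤ |p.2|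
      · simp [Fd_zero_right hρ h2]
      · exact absurd ⟨abs_le.1 (not_le.1 h1).le, abs_le.1 (not_le.1 h2).le⟩ hc
  have hfint : Integrable f (volume.prod volume) := hcont.integrable_of_hasCompactSupport hsupp
  have h1 := integral_prod_symm f hfint
  have h2 : Pd ρ k l = ∫ y, ∫ x, f (x, y) := by
    unfold Pd Hd
    congr 1; funext y
    rw [← integral_const_mul]
    congr 1; funext x
    rw [hf]
    simp only
    rw [← mul_assoc, ← Complex.exp_add]
    congr 2
    push_cast; ring
  rw [h2, ← h1]
  have h3 := Complex.volume_preserving_equiv_real_prod.integral_comp Complex.measurableEquivRealProd.measurableEmbedding f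
  change ∫ z, f z ∂(volume.prod volume) = _
  rw [← Measure.volume_eq_prod, ← h3]
  unfold Phi
  congr 1; funext z
  simp only [Complex.measurableEquivRealProd_apply, hf, Fd]
  rw [Complex.sq_norm, Complex.normSq_apply]
  congr 3; ring

theorem Phi_rot (ρ k l : ℝ) : Phi ρ k l = Phi ρ 0 (Real.sqrt (k^2+l^2)) := by
  by_cases h0 : k = 0 ∧ l = 0
  · obtain ⟨rfl, rfl⟩ := h0; simp
  set r := Real.sqrt (k^2+l^2) with hr
  have hpos : 0 < k^2 + l^2 := by
    by_contra hc
    apply h0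
    constructor <;> nlinarith [sq_nonneg k, sq_nonneg l]
  have hr0 : 0 < r := Real.sqrt_pos.2 hpos
  have hr2 : r^2 = k^2+l^2 := Real.sq_sqrt hpos.le
  set u : ℂ := ⟨l/r, -k/r⟩ with hu
  have hun : ‖u‖ = 1 := by
    have : ‖u‖^2 = 1 := by
      rw [Complex.sq_norm, Complex.normSq_apply, hu]
      field_simp; linarith
    nlinarith [norm_nonneg u, this]
  set c : Circle := ⟨u, by simpa [Submonoid.unitSphere] using hun⟩
  have hm := (rotation c).measurePreserving
  unfold Phi
  rw [← hm.integral_comp (rotation c).toHomeomorph.measurableEmbedding]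
  congr 1; funext z
  have h1 : (rotation c) z = u * z := rfl
  rw [h1, norm_mul, hun, one_mul]
  congr 5
  simp only [Complex.mul_re, Complex.mul_im, hu]
  field_simp
  linear_combination (-z.im) * hr2

theorem Hd_k0 {ρ y s : ℝ} (hs : 0 ≤ s) (h : ρ^2 - y^2 = s^2) : Hd ρ 0 y = 4/3 * (s:ℂ)^3 := by
  rw [Hd_eq hs h]
  simp only [mul_zero, Complex.ofReal_zero, zero_mul, Complex.exp_zero, one_mul]
  have : ∀ x : ℝ, (s:ℂ)^2 - (x:ℂ)^2 = ((s^2 - x^2 : ℝ):ℂ) := by intro x; push_cast; rfl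
  simp_rw [this]
  rw [intervalIntegral.integral_ofReal, intervalIntegral.integral_sub (by simp) (by simp)]
  simp [integral_pow]
  ring

theorem Pd_zero_eq {ρ : ℝ} (hρ : 0 < ρ) (l : ℝ) :
    Pd ρ 0 l = 4/3 * (ρ:ℂ)^4 * ∫ φ in (-(π/2))..(π/2), ((Real.cos φ)^4:ℂ) * Complex.exp (-Complex.I * ((2*π*ρ*l:ℝ):ℂ) * Real.sin φ) := by
  unfold Pd
  rw [whole_to_Icc hρ.le]
  · have hsub := intervalIntegral.integral_deriv_smul_comp (a := -(π/2)) (b := π/2)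
      (f := fun φ => ρ * Real.sin φ) (f' := fun φ => ρ * Real.cos φ)
      (g := fun y : ℝ => Complex.exp (↑(-2 * π * y * l) * Complex.I) * Hd ρ 0 y) ?_ ?_ ?_
    · simp only [Real.sin_neg, Real.sin_pi_div_two, mul_neg, mul_one] at hsub
      rw [← hsub, ← intervalIntegral.integral_const_mul]
      apply intervalIntegral.integral_congr
      intro φ hφ
      rw [Set.uIcc_of_le (by linarith [Real.pi_pos])] at hφ
      have hc := Real.cos_nonneg_of_mem_Icc hφ
      simp only [Function.comp]
      rw [Hd_k0 (s := ρ * Real.cos φ) (by positivity) (by nlinarith [Real.sin_sq_add_cos_sq φ])]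
      rw [Complex.real_smul]
      have : (↑(-2 * π * (ρ * Real.sin φ) * l) * Complex.I : ℂ) = -Complex.I * ((2*π*ρ*l:ℝ):ℂ) * Real.sin φ := by
        push_cast; ring
      rw [this]
      push_cast; ring
    · intro x _
      exact (Real.hasDerivAt_sin x).const_mul ρ
    · fun_prop
    · have := Hd_cont (k := 0) hρ
      fun_prop
  · intro y hy; rw [Hd_zero hρ hy, mul_zero]

theorem Pd_zero_zero {ρ : ℝ} (hρ : 0 < ρ) : Pd ρ 0 0 = ((π * ρ^4/2 : ℝ) : ℂ) := by
  rw [Pd_zero_eq hρ]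
  simp only [mul_zero, Complex.ofReal_zero, zero_mul, Complex.exp_zero, mul_one]
  have : ∀ x : ℝ, (Real.cos x:ℂ)^4 = ((Real.cos x^4 : ℝ):ℂ) := by intro x; push_cast; rfl
  simp_rw [this]
  rw [intervalIntegral.integral_ofReal]
  have key : ∫ x in (-(π/2))..(π/2), Real.cos x^4 = 3*π/8 := by
    rw [integral_cos_pow]; norm_num [integral_cos_sq]; ring
  rw [key]; push_cast; ring

theorem Pd_formula {ρ : ℝ} (hρ : 0 < ρ) (k l : ℝ) (h : 0 < k^2+l^2) :
    Pd ρ k l = ((ρ^2 / (π * (k^2+l^2)) * ((1/π) * ∫ θ in (0:ℝ)..π, Real.cos ((2:ℕ) * θ - (2*π*ρ*Real.sqrt (k^2+l^2)) * Real.sin θ)) : ℝ) : ℂ) := by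
  rw [Pd_eq_Phi hρ, Phi_rot, ← Pd_eq_Phi hρ, Pd_zero_eq hρ]
  set r := Real.sqrt (k^2+l^2) with hr
  have hr0 : 0 < r := Real.sqrt_pos.2 h
  have hr2 : r^2 = k^2+l^2 := Real.sq_sqrt h.le
  have hz : 2*π*ρ*r ≠ 0 := by positivity
  rw [bessel_half _ hz, ← hr2]
  have h1 := bessel_parts (2*π*ρ*r)
  rw [bessel_sym] at h1
  have hzC : ((2*π*ρ*r : ℝ):ℂ) ≠ 0 := by exact_mod_cast hz
  have hzC2 : ((2*π*ρ*r : ℝ):ℂ)^2 ≠ 0 := pow_ne_zero _ hzC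
  have h2 := (eq_div_iff hzC2).2 (mul_comm _ _ |>.trans h1)
  rw [h2]
  have hpi : (π:ℂ) ≠ 0 := by exact_mod_cast Real.pi_ne_zero
  have hρc : (ρ:ℂ) ≠ 0 := by exact_mod_cast hρ.ne'
  have hrc : (r:ℂ) ≠ 0 := by exact_mod_cast hr0.ne'
  generalize (∫ φ in (-(π/2))..(π/2), Real.cos (2*φ) * Real.cos (2*π*ρ*r * Real.sin φ)) = J
  push_cast
  field_simp
  ring

theorem bessel_bound' (z : ℝ) (hz : 0 < z) :
    |∫ θ in (0:ℝ)..π, Real.cos ((2:ℕ) * θ - z * Real.sin θ)| ≤ 50 * z ^ (-(1/3):ℝ) := by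
  rcases le_or_gt 1 z with h | h
  · rw [bessel_half z hz.ne']; exact bessel_bound z h
  · have h1 : ‖∫ θ in (0:ℝ)..π, Real.cos ((2:ℕ) * θ - z * Real.sin θ)‖ ≤ 1 * |π - 0| :=
      intervalIntegral.norm_integral_le_of_norm_le_const fun θ _ => Real.abs_cos_le_one _
    have h2 : 1 ≤ z ^ (-(1/3):ℝ) := Real.one_le_rpow_of_pos_of_le_one_of_nonpos hz h.le (by norm_num)
    rw [sub_zero, abs_of_pos Real.pi_pos, Real.norm_eq_abs] at h1
    refine h1.trans ?_
    have h3 := Real.pi_lt_four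
    linarith

theorem Pd_norm {ρ : ℝ} (hρ : 0 < ρ) (k l : ℝ) (h : 0 < k^2+l^2) :
    ‖Pd ρ k l‖ ≤ (ρ^2/π^2 * 50 * (2*π*ρ) ^ (-(1/3):ℝ)) * (Real.sqrt (k^2+l^2)) ^ (-(7/3):ℝ) := by
  rw [Pd_formula hρ k l h, Complex.norm_real, Real.norm_eq_abs]
  set r := Real.sqrt (k^2+l^2) with hr
  have hr0 : 0 < r := Real.sqrt_pos.2 h
  have hr2 : k^2+l^2 = r^2 := (Real.sq_sqrt h.le).symm
  have hb := bessel_bound' (2*π*ρ*r) (by positivity)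
  rw [Real.mul_rpow (by positivity) hr0.le] at hb
  rw [hr2, abs_mul, abs_mul, abs_of_pos (by positivity : 0 < ρ^2/(π*r^2)), abs_of_pos (by positivity : 0 < 1/π)]
  have e : r ^ (-(7/3):ℝ) = r^(-(1/3):ℝ) / r^2 := by
    rw [← Real.rpow_natCast, ← Real.rpow_sub hr0]; norm_num
  rw [e]
  calc _ ≤ ρ^2/(π*r^2) * (1/π * (50 * ((2*π*ρ) ^ (-(1/3):ℝ) * r ^ (-(1/3):ℝ)))) := by gcongr
    _ = _ := by field_simp

theorem Pd_summable {ρ : ℝ} (hρ : 0 < ρ) : Summable (fun n : ℤ × ℤ => Pd ρ n.1 n.2) := by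
  rw [← (finTwoArrowEquiv ℤ).summable_iff]
  have hs := (EisensteinSeries.summable_one_div_norm_rpow (k := 7/3) (by norm_num)).mul_left
    (ρ^2/π^2 * 50 * (2*π*ρ) ^ (-(1/3):ℝ))
  apply Summable.of_norm_bounded_eventually hs
  filter_upwards [Filter.eventually_cofinite_ne (0 : Fin 2 → ℤ)] with x hx
  simp only [Function.comp, finTwoArrowEquiv_apply]
  have hx0 : 0 < ‖x‖ := norm_pos_iff.2 hx
  have hle : ‖x‖ ≤ Real.sqrt ((x 0 : ℝ)^2 + (x 1:ℝ)^2) := by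
    rw [pi_norm_le_iff_of_nonneg (Real.sqrt_nonneg _)]
    intro i
    rw [Int.norm_eq_abs]
    apply Real.le_sqrt_of_sq_le
    rw [sq_abs]
    fin_cases i <;> simp <;> positivity
  have hpos : 0 < (x 0 : ℝ)^2 + (x 1:ℝ)^2 := Real.sqrt_pos.1 (hx0.trans_le hle)
  refine (Pd_norm hρ _ _ hpos).trans ?_
  refine mul_le_mul_of_nonneg_left ?_ (by positivity)
  exact Real.rpow_le_rpow_of_nonpos hx0 hle (by norm_num)

theorem poisson2 {ρ : ℝ} (hρ : 0 < ρ) (M : ℕ) (hM : ρ ≤ M) :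
    ∑ n ∈ Finset.Icc (-(M:ℤ)) M ×ˢ Finset.Icc (-(M:ℤ)) M, (Fd ρ n.1 n.2 : ℂ) = ∑' n : ℤ × ℤ, Pd ρ n.1 n.2 := by
  have hout : ∀ m : ℤ, m ∉ Finset.Icc (-(M:ℤ)) M → ρ ≤ |(m:ℝ)| := by
    intro m hm
    refine hM.trans ?_
    rw [Finset.mem_Icc, ← abs_le, not_le] at hm
    exact_mod_cast hm.le
  have h1 : ∀ y : ℝ, ∑ m ∈ Finset.Icc (-(M:ℤ)) M, (Fd ρ m y : ℂ) = ∑' k : ℤ, Hd ρ k y := by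
    intro y
    simp_rw [Hd_fourier]
    rw [← poisson1 (ρ := ρ) (fun x => (Fd ρ x y : ℂ)) (by unfold Fd; fun_prop) (fun x hx => by simp [Fd_zero_left hρ hx])]
    · rw [tsum_eq_sum]
      intro m hm
      simp [Fd_zero_left hρ (hout m hm)]
    · simp_rw [← Hd_fourier]; exact Hd_summable
  have h2 : ∀ k : ℤ, ∑ l ∈ Finset.Icc (-(M:ℤ)) M, Hd ρ k l = ∑' l : ℤ, Pd ρ k l := by
    intro k
    simp_rw [Pd_fourier]
    rw [← poisson1 (ρ := ρ) (Hd ρ k) (Hd_cont hρ) (fun x hx => Hd_zero hρ hx)]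
    · rw [tsum_eq_sum]
      intro m hm
      exact Hd_zero hρ (hout m hm)
    · simp_rw [← Pd_fourier]; exact (Pd_summable hρ).prod_factor k
  rw [Finset.sum_product_right]
  simp_rw [h1]
  rw [← Summable.tsum_finsetSum (fun _ _ => Hd_summable)]
  simp_rw [h2]
  exact ((Pd_summable hρ).tsum_prod).symm

theorem int_step (R c : ℝ) (hc : 0 ≤ c) (hR : 0 < R) :
    IntervalIntegrable (fun t : ℝ => if c ≤ t then (1:ℝ) else 0) volume 0 R ∧
    ∫ t in (0:ℝ)..R, (if c ≤ t then (1:ℝ) else 0) = max (R - c) 0 := by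
  have hf : (fun t : ℝ => if c ≤ t then (1:ℝ) else 0) = (Set.Ici c).indicator (fun _ => 1) := by
    funext t; simp [Set.indicator]
  rw [hf]
  constructor
  · rw [intervalIntegrable_iff_integrableOn_Ioc_of_le hR.le]
    exact (integrable_const (1:ℝ)).indicator measurableSet_Ici
  · rw [intervalIntegral.integral_of_le hR.le, integral_indicator measurableSet_Ici,
      Measure.restrict_restrict measurableSet_Ici]
    have : (Set.Ici c ∩ Set.Ioc 0 R : Set ℝ) =ᵐ[volume] Set.Ioc c R := by
      have h1 : (Set.Ioi c ∩ Set.Ioc 0 R : Set ℝ) = Set.Ioc c R := by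
        ext t; simp only [Set.mem_inter_iff, Set.mem_Ioi, Set.mem_Ioc]
        constructor
        · rintro ⟨a, b, d⟩; exact ⟨a, d⟩
        · rintro ⟨a, d⟩; exact ⟨a, by linarith, d⟩
      rw [← h1]
      exact Ioi_ae_eq_Ici.symm.inter (Filter.EventuallyEq.refl _ _)
    rw [setIntegral_congr_set this]
    simp

theorem Nlat_eq {ρ R t : ℝ} (hρ : 0 < ρ) (hR : (2*π*ρ)^2 = R) (M : ℕ) (hM : ρ ≤ M) (ht0 : 0 ≤ t) (ht : t ≤ R) :
    (Nlat t : ℝ) = ∑ n ∈ Finset.Icc (-(M:ℤ)) M ×ˢ Finset.Icc (-(M:ℤ)) M,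
      if 4 * π^2 * ((n.1:ℝ)^2+(n.2:ℝ)^2) ≤ t then (1:ℝ) else 0 := by
  have hiff : ∀ n : ℤ × ℤ, znorm n ≤ Real.sqrt t / (2*π) ↔ 4 * π^2 * ((n.1:ℝ)^2+(n.2:ℝ)^2) ≤ t := by
    intro n
    unfold znorm
    rw [le_div_iff₀ (by positivity), Real.le_sqrt (by positivity) ht0, mul_pow, Real.sq_sqrt (by positivity)]
    ring_nf
  have hset : {n : ℤ × ℤ | znorm n ≤ Real.sqrt t / (2 * π)} =
      ((Finset.Icc (-(M:ℤ)) M ×ˢ Finset.Icc (-(M:ℤ)) M).filter (fun n : ℤ × ℤ => 4 * π^2 * ((n.1:ℝ)^2+(n.2:ℝ)^2) ≤ t) : Finset (ℤ × ℤ)) := by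
    ext n
    rw [Finset.coe_filter, Set.mem_ofPred_eq, Set.mem_ofPred_eq, hiff]
    constructor
    · intro h
      refine ⟨?_, h⟩
      have h1 : 4 * π^2 * ((n.1:ℝ)^2+(n.2:ℝ)^2) ≤ 4 * π^2 * ρ^2 := by
        calc _ ≤ R := h.trans ht
          _ = _ := by rw [← hR]; ring
      have h2 : (n.1:ℝ)^2+(n.2:ℝ)^2 ≤ ρ^2 := le_of_mul_le_mul_left h1 (by positivity)
      rw [Finset.mem_product, Finset.mem_Icc, Finset.mem_Icc, ← abs_le, ← abs_le]
      constructor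
      · have : |(n.1:ℝ)| ≤ M := (abs_le_of_sq_le_sq (by nlinarith [sq_nonneg (n.2:ℝ)]) hρ.le).trans hM
        exact_mod_cast this
      · have : |(n.2:ℝ)| ≤ M := (abs_le_of_sq_le_sq (by nlinarith [sq_nonneg (n.1:ℝ)]) hρ.le).trans hM
        exact_mod_cast this
    · exact fun h => h.2
  unfold Nlat
  rw [hset, Set.ncard_coe_finset, Finset.sum_ite]
  simp

theorem int_Dlat {ρ R : ℝ} (hρ : 0 < ρ) (hR : (2*π*ρ)^2 = R) (M : ℕ) (hM : ρ ≤ M) :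
    ∫ t in (0:ℝ)..R, Dlat t = 4 * π^2 * (∑ n ∈ Finset.Icc (-(M:ℤ)) M ×ˢ Finset.Icc (-(M:ℤ)) M, Fd ρ n.1 n.2) - R^2/(8*π) := by
  have hR0 : 0 < R := by rw [← hR]; positivity
  have h1 : ∫ t in (0:ℝ)..R, Dlat t = ∫ t in (0:ℝ)..R, ((∑ n ∈ Finset.Icc (-(M:ℤ)) M ×ˢ Finset.Icc (-(M:ℤ)) M,
      if 4 * π^2 * ((n.1:ℝ)^2+(n.2:ℝ)^2) ≤ t then (1:ℝ) else 0) - t/(4*π)) := by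
    apply intervalIntegral.integral_congr
    intro t ht
    rw [Set.uIcc_of_le hR0.le] at ht
    simp only [Dlat]
    rw [Nlat_eq hρ hR M hM ht.1 ht.2]
  have hst := fun n : ℤ × ℤ => int_step R (4 * π^2 * ((n.1:ℝ)^2+(n.2:ℝ)^2)) (by positivity) hR0
  rw [h1, intervalIntegral.integral_sub, intervalIntegral.integral_finsetSum]
  · rw [Finset.mul_sum]
    congr 1
    · apply Finset.sum_congr rfl
      intro n _
      rw [(hst n).2]
      unfold Fd
      rw [mul_max_of_nonneg _ _ (by positivity), mul_zero, ← hR]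
      congr 1; ring
    · simp; field_simp; ring
  · exact fun n _ => (hst n).1
  · have := IntervalIntegrable.sum (μ := volume) (a := 0) (b := R) (Finset.Icc (-(M:ℤ)) M ×ˢ Finset.Icc (-(M:ℤ)) M)
      (f := fun (n : ℤ × ℤ) (t:ℝ) => if 4 * π^2 * ((n.1:ℝ)^2+(n.2:ℝ)^2) ≤ t then (1:ℝ) else 0) (fun n _ => (hst n).1)
    refine this.congr ?_
    intro t _; simp
  · apply Continuous.intervalIntegrable; fun_prop

/-- For every `R > 0`,
`A(R) = Σ_{n ∈ ℤ², n ≠ 0} (1/(π‖n‖²)) J₂(‖n‖√R)`, the series converging absolutely. -/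
theorem average_eq_bessel_sum (R : ℝ) (hR : 0 < R) :
    Summable (fun n : {n : ℤ × ℤ // n ≠ 0} =>
      |(1 / (π * znorm n.1 ^ 2)) * besselJ 2 (znorm n.1 * Real.sqrt R)|) ∧
    Alat R = ∑' n : {n : ℤ × ℤ // n ≠ 0},
      (1 / (π * znorm n.1 ^ 2)) * besselJ 2 (znorm n.1 * Real.sqrt R) := by
  obtain ⟨ρ, hρdef⟩ : ∃ ρ, ρ = Real.sqrt R / (2*π) := ⟨_, rfl⟩
  have hρ : 0 < ρ := by rw [hρdef]; positivity
  have hsR : 2*π*ρ = Real.sqrt R := by rw [hρdef]; field_simp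
  have hR2 : (2*π*ρ)^2 = R := by rw [hsR, Real.sq_sqrt hR.le]
  set T : {n : ℤ × ℤ // n ≠ 0} → ℝ := fun n => (1 / (π * znorm n.1 ^ 2)) * besselJ 2 (znorm n.1 * Real.sqrt R) with hT
  have hPT : ∀ n : {n : ℤ × ℤ // n ≠ 0}, Pd ρ n.1.1 n.1.2 = ((ρ^2 * T n : ℝ) : ℂ) := by
    rintro ⟨⟨a, b⟩, hn⟩
    have hpos : 0 < (a:ℝ)^2 + (b:ℝ)^2 := by
      by_contra hc
      apply hn
      have h1 : (a:ℝ) = 0 := by nlinarith [sq_nonneg (a:ℝ), sq_nonneg (b:ℝ)]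
      have h2 : (b:ℝ) = 0 := by nlinarith [sq_nonneg (a:ℝ), sq_nonneg (b:ℝ)]
      ext <;> simp <;> assumption_mod_cast
    rw [Pd_formula hρ _ _ hpos, hT]
    simp only [znorm, besselJ]
    rw [hsR, mul_comm (Real.sqrt R), Real.sq_sqrt hpos.le]
    congr 1
    ring
  have hPs := Pd_summable hρ
  have hsub : Summable (fun n : {n : ℤ × ℤ // n ≠ 0} => Pd ρ n.1.1 n.1.2) := hPs.subtype {n : ℤ × ℤ | n ≠ 0}
  simp_rw [hPT] at hsub
  have hTs : Summable T := by
    have := Complex.summable_ofReal.1 hsub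
    exact (summable_mul_left_iff (by positivity)).1 this
  refine ⟨hTs.abs, ?_⟩
  obtain ⟨M, hM⟩ := exists_nat_ge ρ
  have hP := poisson2 hρ M hM
  have hsplit : ∑' n : ℤ × ℤ, Pd ρ n.1 n.2 = Pd ρ 0 0 + ∑' n : {n : ℤ × ℤ // n ≠ 0}, Pd ρ n.1.1 n.1.2 := by
    rw [← hPs.tsum_subtype_add_tsum_subtype_compl {(0 : ℤ × ℤ)}]
    congr 1
    rw [tsum_singleton (0 : ℤ × ℤ) (fun n => Pd ρ n.1 n.2)]; simp
  rw [hsplit, Pd_zero_zero hρ] at hP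
  simp_rw [hPT] at hP
  rw [← Complex.ofReal_tsum, tsum_mul_left] at hP
  have hP' : ∑ n ∈ Finset.Icc (-(M:ℤ)) M ×ˢ Finset.Icc (-(M:ℤ)) M, Fd ρ n.1 n.2 = π * ρ^4/2 + ρ^2 * ∑' n, T n := by
    exact_mod_cast hP
  unfold Alat
  rw [int_Dlat hρ hR2 M hM, hP', ← hR2]
  field_simp
  ring
end

section
/- There exists a constant C > 0 such that for all R ≥ 1, |A(R) − g(√R)·R^{-1/4}| ≤ C·R^{-3/4}, where g(x) = −(√2/π^{3/2}) Σ_{n ∈ ℤ², n ≠ 0} ‖n‖^{-5/2} cos(‖n‖x − π/4). -/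
open Real MeasureTheory

/-- `g(x) = −(√2/π^{3/2}) Σ_{n ≠ 0} ‖n‖^{-5/2} cos(‖n‖x − π/4)`. -/
noncomputable def gfun (x : ℝ) : ℝ :=
  -(Real.sqrt 2 / π ^ ((3:ℝ)/2)) *
    ∑' n : {n : ℤ × ℤ // n ≠ 0}, znorm n.1 ^ (-(5/2) : ℝ) * Real.cos (znorm n.1 * x - π/4)

/-! ### Part 1: asymptotics of the Bessel-type integral -/

lemma aux_real_mul_cpow (y : ℝ) (hy : 0 < y) (w : ℂ) (hw : w ≠ 0) (s : ℝ) :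
    ((y : ℂ) * w) ^ (s : ℂ) = ((y ^ s : ℝ) : ℂ) * w ^ (s : ℂ) := by
  have hy' : (y : ℂ) ≠ 0 := by exact_mod_cast hy.ne'
  rw [Complex.cpow_def_of_ne_zero (mul_ne_zero hy' hw), Complex.cpow_def_of_ne_zero hw,
    Complex.log_ofReal_mul hy hw, add_mul, Complex.exp_add, Real.rpow_def_of_pos hy]
  push_cast
  rfl

lemma aux_cpow_diff (c : ℂ) (him : c.im ≠ 0) (hn : ‖c‖ = 2) (y : ℝ)
    (hy : 0 ≤ y) :
    ‖((y : ℂ) + c) ^ ((3/2 : ℝ) : ℂ) - c ^ ((3/2 : ℝ) : ℂ)‖ ≤ (3/2) * (y + 2) * y := by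
  have hd : ∀ t ∈ Set.Icc (0:ℝ) y, HasDerivWithinAt
      (fun t : ℝ => ((t : ℂ) + c) ^ ((3/2 : ℝ) : ℂ))
      (((3/2 : ℝ) : ℂ) * ((t : ℂ) + c) ^ (((3/2 : ℝ) : ℂ) - 1)) (Set.Icc 0 y) t := by
    intro t ht
    have hs : (t : ℂ) + c ∈ Complex.slitPlane := by
      right; simpa using him
    have h1 := (Complex.hasStrictDerivAt_cpow_const (c := ((3/2 : ℝ) : ℂ)) hs).hasDerivAt
    have h2 : HasDerivAt (fun t : ℝ => (t : ℂ) + c) 1 t :=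
      (Complex.ofRealCLM.hasDerivAt (x := t)).add_const c
    have h3 := h1.comp t h2
    simpa [Function.comp_def] using h3.hasDerivWithinAt
  have hb : ∀ t ∈ Set.Icc (0:ℝ) y,
      ‖((3/2 : ℝ) : ℂ) * ((t : ℂ) + c) ^ (((3/2 : ℝ) : ℂ) - 1)‖ ≤ (3/2) * (y + 2) := by
    intro t ht
    have e : (((3/2 : ℝ) : ℂ) - 1) = ((1/2 : ℝ) : ℂ) := by push_cast; norm_num
    rw [e, norm_mul, Complex.norm_cpow_real, Complex.norm_real]
    have h1 : ‖(t : ℂ) + c‖ ≤ y + 2 := by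
      refine (norm_add_le _ _).trans ?_
      rw [hn, Complex.norm_real, Real.norm_of_nonneg ht.1]
      linarith [ht.2]
    have h2 : ‖(t : ℂ) + c‖ ^ (1/2 : ℝ) ≤ y + 2 := by
      calc ‖(t : ℂ) + c‖ ^ (1/2 : ℝ) ≤ (y + 2) ^ (1/2 : ℝ) :=
            Real.rpow_le_rpow (norm_nonneg _) h1 (by norm_num)
        _ ≤ (y + 2) ^ (1 : ℝ) := Real.rpow_le_rpow_of_exponent_le (by linarith) (by norm_num)
        _ = y + 2 := Real.rpow_one _
    have : ‖(3/2 : ℝ)‖ = 3/2 := by norm_num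
    rw [this]
    linarith
  have := Convex.norm_image_sub_le_of_norm_hasDerivWithin_le hd hb (convex_Icc 0 y)
    (Set.left_mem_Icc.2 hy) (Set.right_mem_Icc.2 hy)
  simpa [Real.norm_of_nonneg hy, abs_of_nonneg hy] using this

lemma aux_int_rpow_exp (a l : ℝ) (ha : -1 < a) (hl : 0 < l) :
    IntegrableOn (fun y : ℝ => y ^ a * Real.exp (-(l * y))) (Set.Ioi 0) := by
  have := integrableOn_rpow_mul_exp_neg_mul_rpow (p := 1) (s := a) (b := l) ha one_pos hl
  simpa using this

/-- the vertical-side integrand -/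
noncomputable def vfun (c : ℂ) (l : ℝ) (y : ℝ) : ℂ :=
  ((y : ℂ) * ((y : ℂ) + c)) ^ ((3/2 : ℝ) : ℂ) * ((Real.exp (-(l * y)) : ℝ) : ℂ)

lemma vfun_diff (c : ℂ) (him : c.im ≠ 0) (hn : ‖c‖ = 2) (l y : ℝ) (hy : 0 < y) :
    ‖vfun c l y - c ^ ((3/2 : ℝ) : ℂ) * ((y ^ (3/2 : ℝ) * Real.exp (-(l * y)) : ℝ) : ℂ)‖ ≤
      (3/2) * (y ^ (7/2 : ℝ) * Real.exp (-(l * y))) + 3 * (y ^ (5/2 : ℝ) * Real.exp (-(l * y))) := by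
  have hne : (y : ℂ) + c ≠ 0 := by
    intro h; apply him; simpa using congrArg Complex.im h
  unfold vfun
  rw [aux_real_mul_cpow y hy _ hne]
  have e : ((y ^ (3/2 : ℝ) : ℝ) : ℂ) * ((y : ℂ) + c) ^ ((3/2 : ℝ) : ℂ) * ((Real.exp (-(l * y)) : ℝ) : ℂ)
      - c ^ ((3/2 : ℝ) : ℂ) * ((y ^ (3/2 : ℝ) * Real.exp (-(l * y)) : ℝ) : ℂ)
      = ((y ^ (3/2 : ℝ) * Real.exp (-(l * y)) : ℝ) : ℂ) *
        (((y : ℂ) + c) ^ ((3/2 : ℝ) : ℂ) - c ^ ((3/2 : ℝ) : ℂ)) := by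
    push_cast; ring
  rw [e, norm_mul, Complex.norm_real, Real.norm_of_nonneg (by positivity)]
  have h := aux_cpow_diff c him hn y hy.le
  have h7 : y ^ (7/2 : ℝ) = y ^ (3/2 : ℝ) * y * y := by
    rw [← Real.rpow_add_one hy.ne', ← Real.rpow_add_one hy.ne']; norm_num
  have h5 : y ^ (5/2 : ℝ) = y ^ (3/2 : ℝ) * y := by
    rw [← Real.rpow_add_one hy.ne']; norm_num
  rw [h7, h5]
  calc _ ≤ y ^ (3/2 : ℝ) * Real.exp (-(l * y)) * ((3/2) * (y + 2) * y) := by gcongr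
    _ = _ := by ring

lemma vfun_integrable (c : ℂ) (him : c.im ≠ 0) (hn : ‖c‖ = 2) (l : ℝ) (hl : 0 < l) :
    IntegrableOn (vfun c l) (Set.Ioi 0) := by
  have h3 := aux_int_rpow_exp (3/2) l (by norm_num) hl
  have h5 := aux_int_rpow_exp (5/2) l (by norm_num) hl
  have h7 := aux_int_rpow_exp (7/2) l (by norm_num) hl
  have hm : Measurable (vfun c l) := by
    unfold vfun; fun_prop
  have hc3 : IntegrableOn (fun y : ℝ => c ^ ((3/2 : ℝ) : ℂ) *
      ((y ^ (3/2 : ℝ) * Real.exp (-(l * y)) : ℝ) : ℂ)) (Set.Ioi 0) :=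
    Integrable.const_mul (Integrable.ofReal h3) _
  have hd : IntegrableOn (fun y : ℝ => vfun c l y - c ^ ((3/2 : ℝ) : ℂ) *
      ((y ^ (3/2 : ℝ) * Real.exp (-(l * y)) : ℝ) : ℂ)) (Set.Ioi 0) := by
    refine Integrable.mono' ((h7.const_mul (3/2)).add (h5.const_mul 3)) ?_ ?_
    · exact (hm.aestronglyMeasurable).sub hc3.aestronglyMeasurable
    · exact (ae_restrict_iff' measurableSet_Ioi).2
        (Filter.Eventually.of_forall fun y hy => vfun_diff c him hn l y hy)
  have := hd.add hc3
  refine this.congr (Filter.Eventually.of_forall fun y => ?_)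
  simp

lemma vfun_asymp (c : ℂ) (him : c.im ≠ 0) (hn : ‖c‖ = 2) (l : ℝ) (hl : 1 ≤ l) :
    ‖(∫ y in Set.Ioi (0:ℝ), vfun c l y) - c ^ ((3/2 : ℝ) : ℂ) *
      ((l ^ (-(5/2) : ℝ) * Real.Gamma (5/2) : ℝ) : ℂ)‖ ≤
      ((3/2) * Real.Gamma (9/2) + 3 * Real.Gamma (7/2)) * l ^ (-(7/2) : ℝ) := by
  have hl0 : 0 < l := by linarith
  have h3 := aux_int_rpow_exp (3/2) l (by norm_num) hl0
  have h5 := aux_int_rpow_exp (5/2) l (by norm_num) hl0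
  have h7 := aux_int_rpow_exp (7/2) l (by norm_num) hl0
  have key : ∀ a : ℝ, 0 < a → ∫ y in Set.Ioi (0:ℝ), y ^ (a - 1) * Real.exp (-(l * y)) =
      l ^ (-a) * Real.Gamma a := by
    intro a ha
    rw [Real.integral_rpow_mul_exp_neg_mul_Ioi ha hl0, one_div, Real.inv_rpow hl0.le,
      Real.rpow_neg hl0.le]
  have k3 := key (5/2) (by norm_num)
  have k5 := key (7/2) (by norm_num)
  have k7 := key (9/2) (by norm_num)
  norm_num at k3 k5 k7
  have hc3 : IntegrableOn (fun y : ℝ => c ^ ((3/2 : ℝ) : ℂ) *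
      ((y ^ (3/2 : ℝ) * Real.exp (-(l * y)) : ℝ) : ℂ)) (Set.Ioi 0) :=
    Integrable.const_mul (Integrable.ofReal h3) _
  have e : c ^ ((3/2 : ℝ) : ℂ) * ((l ^ (-(5/2) : ℝ) * Real.Gamma (5/2) : ℝ) : ℂ) =
      ∫ y in Set.Ioi (0:ℝ), c ^ ((3/2 : ℝ) : ℂ) *
        ((y ^ (3/2 : ℝ) * Real.exp (-(l * y)) : ℝ) : ℂ) := by
    rw [integral_const_mul, integral_complex_ofReal, k3]
  rw [e, ← integral_sub (vfun_integrable c him hn l hl0) hc3]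
  have hb : ∀ᵐ y ∂(volume.restrict (Set.Ioi (0:ℝ))), ‖vfun c l y - c ^ ((3/2 : ℝ) : ℂ) *
        ((y ^ (3/2 : ℝ) * Real.exp (-(l * y)) : ℝ) : ℂ)‖ ≤
      (3/2) * (y ^ (7/2 : ℝ) * Real.exp (-(l * y))) + 3 * (y ^ (5/2 : ℝ) * Real.exp (-(l * y))) :=
    (ae_restrict_iff' measurableSet_Ioi).2
        (Filter.Eventually.of_forall fun y hy => vfun_diff c him hn l y hy)
  refine (norm_integral_le_of_norm_le ((h7.const_mul (3/2)).add (h5.const_mul 3)) hb).trans ?_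
  have : (∫ y in Set.Ioi (0:ℝ), ((fun y : ℝ => (3/2) * (y ^ (7/2 : ℝ) * Real.exp (-(l * y)))) +
      fun y : ℝ => 3 * (y ^ (5/2 : ℝ) * Real.exp (-(l * y)))) y) =
      (3/2) * (l ^ (-(9/2) : ℝ) * Real.Gamma (9/2)) + 3 * (l ^ (-(7/2) : ℝ) * Real.Gamma (7/2)) := by
    rw [integral_add' (h7.const_mul (3/2)) (h5.const_mul 3), integral_const_mul,
      integral_const_mul, k5, k7]
  refine (le_of_eq this).trans ?_
  have hle : l ^ (-(9/2) : ℝ) ≤ l ^ (-(7/2) : ℝ) :=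
    Real.rpow_le_rpow_of_exponent_le hl (by norm_num)
  have hG : 0 < Real.Gamma (9/2) := Real.Gamma_pos_of_pos (by norm_num)
  nlinarith [mul_le_mul_of_nonneg_right hle hG.le]

/-- the integrand on the rectangle -/
noncomputable def rfun (l : ℝ) (z : ℂ) : ℂ :=
  (1 - z ^ 2) ^ ((3/2 : ℝ) : ℂ) * Complex.exp (Complex.I * l * z)

lemma rfun_rect (l T : ℝ) (hT : 0 < T) :
    (∫ x in (-1:ℝ)..1, rfun l x) - (∫ x in (-1:ℝ)..1, rfun l (x + T * Complex.I)) +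
      Complex.I * Complex.exp (Complex.I * l) * (∫ y in (0:ℝ)..T, vfun (-(2 * Complex.I)) l y) -
      Complex.I * Complex.exp (-(Complex.I * l)) * (∫ y in (0:ℝ)..T, vfun (2 * Complex.I) l y) = 0 := by
  have h := Complex.integral_boundary_rect_eq_zero_of_continuousOn_of_differentiableOn (rfun l)
    (-1) (1 + T * Complex.I) ?_ ?_
  · have e1 : ∀ y : ℝ, rfun l (1 + y * Complex.I) =
        Complex.exp (Complex.I * l) * vfun (-(2 * Complex.I)) l y := by
      intro y
      unfold rfun vfun
      rw [show Complex.I * l * (1 + y * Complex.I) = Complex.I * l + ((-(l * y) : ℝ) : ℂ) by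
        push_cast; linear_combination (l * y : ℂ) * Complex.I_sq, Complex.exp_add,
        Complex.ofReal_exp]
      rw [show (1 - (1 + (y:ℂ) * Complex.I) ^ 2) = y * (y + -(2 * Complex.I)) by
        linear_combination (-(y:ℂ)^2) * Complex.I_sq]
      ring
    have e2 : ∀ y : ℝ, rfun l (-1 + y * Complex.I) =
        Complex.exp (-(Complex.I * l)) * vfun (2 * Complex.I) l y := by
      intro y
      unfold rfun vfun
      rw [show Complex.I * l * (-1 + y * Complex.I) = -(Complex.I * l) + ((-(l * y) : ℝ) : ℂ) by
        push_cast; linear_combination (l * y : ℂ) * Complex.I_sq, Complex.exp_add,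
        Complex.ofReal_exp]
      rw [show (1 - (-1 + (y:ℂ) * Complex.I) ^ 2) = y * (y + (2 * Complex.I)) by
        linear_combination (-(y:ℂ)^2) * Complex.I_sq]
      ring
    simp only [Complex.neg_re, Complex.one_re, Complex.neg_im, Complex.one_im, neg_zero,
      Complex.add_re, Complex.mul_re, Complex.ofReal_re, Complex.I_re, Complex.ofReal_im,
      Complex.I_im, Complex.add_im, Complex.mul_im, mul_zero, mul_one, zero_mul, sub_zero, add_zero,
      zero_add, Complex.ofReal_zero, Complex.ofReal_one, Complex.ofReal_neg, e1, e2,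
      intervalIntegral.integral_const_mul, smul_eq_mul, sub_self] at h
    rw [← h]; ring
  · intro z hz
    simp only [Complex.neg_re, Complex.one_re, Complex.neg_im, Complex.one_im, neg_zero,
      Complex.add_re, Complex.mul_re, Complex.ofReal_re, Complex.I_re, Complex.ofReal_im,
      Complex.I_im, Complex.add_im, Complex.mul_im, mul_zero, mul_one, zero_mul, sub_zero, add_zero,
      zero_add, sub_self, Complex.mem_reProdIm] at hz
    rw [Set.uIcc_of_le (by norm_num), Set.uIcc_of_le hT.le] at hz
    refine ContinuousAt.continuousWithinAt ?_
    unfold rfun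
    refine ContinuousAt.mul ?_ (by fun_prop)
    have h1 : ContinuousAt (fun x : ℂ => x ^ ((3/2 : ℝ) : ℂ)) (1 - z ^ 2) := by
      apply Complex.continuousAt_cpow_const_of_re_pos
      · left
        simp only [Complex.sub_re, Complex.one_re, pow_two, Complex.mul_re]
        nlinarith [hz.1.1, hz.1.2, sq_nonneg z.im]
      · rw [Complex.ofReal_re]; norm_num
    exact ContinuousAt.comp (f := fun z : ℂ => 1 - z ^ 2) h1 (by fun_prop)
  · intro z hz
    simp only [Complex.neg_re, Complex.one_re, Complex.neg_im, Complex.one_im, neg_zero,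
      Complex.add_re, Complex.mul_re, Complex.ofReal_re, Complex.I_re, Complex.ofReal_im,
      Complex.I_im, Complex.add_im, Complex.mul_im, mul_zero, mul_one, zero_mul, sub_zero, add_zero,
      zero_add, sub_self, Complex.mem_reProdIm] at hz
    rw [min_eq_left (by norm_num), max_eq_right (by norm_num)] at hz
    refine DifferentiableAt.differentiableWithinAt ?_
    unfold rfun
    refine DifferentiableAt.mul ?_ (by fun_prop)
    refine DifferentiableAt.cpow_const (by fun_prop) ?_
    left
    simp only [Complex.sub_re, Complex.one_re, pow_two, Complex.mul_re]
    nlinarith [hz.1.1, hz.1.2, sq_nonneg z.im]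

lemma rfun_top (l : ℝ) (hl : 0 < l) :
    Filter.Tendsto (fun T : ℝ => ∫ x in (-1:ℝ)..1, rfun l (x + T * Complex.I)) Filter.atTop
      (nhds 0) := by
  have hb : ∀ T : ℝ, ‖∫ x in (-1:ℝ)..1, rfun l (x + T * Complex.I)‖ ≤
      (2 + T ^ 2) ^ 2 * Real.exp (-l * T) * |1 - (-1 : ℝ)| := by
    intro T
    refine intervalIntegral.norm_integral_le_of_norm_le_const fun x hx => ?_
    rw [Set.uIoc_of_le (by norm_num)] at hx
    unfold rfun
    rw [norm_mul, Complex.norm_cpow_real, Complex.norm_exp]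
    have e : (Complex.I * l * (x + T * Complex.I)).re = -l * T := by simp
    rw [e]
    gcongr
    have hn : ‖1 - ((x:ℂ) + T * Complex.I) ^ 2‖ ≤ 2 + T ^ 2 := by
      refine (norm_sub_le _ _).trans ?_
      rw [norm_one, norm_pow, ← Complex.normSq_eq_norm_sq, Complex.normSq_add_mul_I]
      nlinarith [hx.1, hx.2]
    calc ‖1 - ((x:ℂ) + T * Complex.I) ^ 2‖ ^ (3/2 : ℝ) ≤ (2 + T ^ 2) ^ (3/2 : ℝ) :=
          Real.rpow_le_rpow (norm_nonneg _) hn (by norm_num)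
      _ ≤ (2 + T ^ 2) ^ (2 : ℝ) :=
          Real.rpow_le_rpow_of_exponent_le (by nlinarith [sq_nonneg T]) (by norm_num)
      _ = (2 + T ^ 2) ^ 2 := by norm_cast
  refine squeeze_zero_norm hb ?_
  have t := fun n : ℕ => Real.tendsto_pow_mul_exp_neg_atTop_nhds_zero n
  have hlim : ∀ n : ℕ, Filter.Tendsto (fun T : ℝ => T ^ n * Real.exp (-l * T)) Filter.atTop
      (nhds 0) := by
    intro n
    have := tendsto_rpow_mul_exp_neg_mul_atTop_nhds_zero n l hl
    simpa using this
  have := ((((hlim 0).const_mul 4).add ((hlim 2).const_mul 4)).add (hlim 4)).mul_const |1 - (-1 : ℝ)|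
  simp only [mul_zero, add_zero, zero_mul] at this
  refine this.congr fun T => ?_
  ring

lemma rfun_eq (l : ℝ) (hl : 0 < l) :
    (∫ x in (-1:ℝ)..1, rfun l x) =
      Complex.I * Complex.exp (-(Complex.I * l)) * (∫ y in Set.Ioi (0:ℝ), vfun (2 * Complex.I) l y) -
      Complex.I * Complex.exp (Complex.I * l) *
        (∫ y in Set.Ioi (0:ℝ), vfun (-(2 * Complex.I)) l y) := by
  have t1 := intervalIntegral_tendsto_integral_Ioi (0:ℝ)
    (vfun_integrable (2 * Complex.I) (by simp) (by simp) l hl) Filter.tendsto_id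
  have t2 := intervalIntegral_tendsto_integral_Ioi (0:ℝ)
    (vfun_integrable (-(2 * Complex.I)) (by simp) (by simp) l hl) Filter.tendsto_id
  have t := ((rfun_top l hl).add
    (t1.const_mul (Complex.I * Complex.exp (-(Complex.I * l))))).sub
    (t2.const_mul (Complex.I * Complex.exp (Complex.I * l)))
  rw [zero_add] at t
  refine tendsto_nhds_unique (tendsto_const_nhds.congr' ?_) t
  filter_upwards [Filter.eventually_gt_atTop 0] with T hT
  simp only [id]
  linear_combination rfun_rect l T hT

/-- The Bessel-type integral. -/
noncomputable def bint (l : ℝ) : ℝ :=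
  ∫ s in (-1:ℝ)..1, (1 - s ^ 2) ^ (3/2 : ℝ) * Real.cos (l * s)

lemma bint_eq (l : ℝ) : bint l = (∫ x in (-1:ℝ)..1, rfun l x).re := by
  have hc : Continuous fun x : ℝ => (1 - x ^ 2) ^ (3/2 : ℝ) :=
    Continuous.rpow_const (by fun_prop) (fun _ => Or.inr (by norm_num))
  have hr : ∀ x ∈ Set.uIcc (-1:ℝ) 1, rfun l x =
      (((1 - x ^ 2) ^ (3/2 : ℝ) : ℝ) : ℂ) * Complex.exp (Complex.I * l * x) := by
    intro x hx
    rw [Set.uIcc_of_le (by norm_num)] at hx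
    unfold rfun
    rw [Complex.ofReal_cpow (by nlinarith [hx.1, hx.2])]
    push_cast; rfl
  rw [intervalIntegral.integral_congr hr]
  have hi : IntervalIntegrable (fun x : ℝ => (((1 - x ^ 2) ^ (3/2 : ℝ) : ℝ) : ℂ) *
      Complex.exp (Complex.I * l * x)) volume (-1) 1 := by
    apply Continuous.intervalIntegrable
    refine Continuous.mul (Complex.continuous_ofReal.comp hc) (by fun_prop)
  have := Complex.reCLM.intervalIntegral_comp_comm hi
  simp only [Complex.reCLM_apply] at this
  rw [← this]
  unfold bint
  refine intervalIntegral.integral_congr fun x _ => ?_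
  simp only [Complex.re_ofReal_mul]
  rw [show Complex.I * l * x = ((l * x : ℝ) : ℂ) * Complex.I by push_cast; ring,
    Complex.exp_ofReal_mul_I_re]

lemma two_I_cpow : (2 * Complex.I) ^ ((3/2 : ℝ) : ℂ) =
    ((2 ^ (3/2 : ℝ) : ℝ) : ℂ) * Complex.exp ((3 * π / 4 : ℝ) * Complex.I) := by
  rw [show (2 * Complex.I) = ((2:ℝ) : ℂ) * Complex.I by norm_num,
    aux_real_mul_cpow 2 two_pos _ Complex.I_ne_zero, Complex.cpow_def_of_ne_zero Complex.I_ne_zero,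
    Complex.log_I]
  congr 2
  push_cast; ring

lemma neg_two_I_cpow : (-(2 * Complex.I)) ^ ((3/2 : ℝ) : ℂ) =
    ((2 ^ (3/2 : ℝ) : ℝ) : ℂ) * Complex.exp (-((3 * π / 4 : ℝ) * Complex.I)) := by
  rw [show -(2 * Complex.I) = ((2:ℝ) : ℂ) * (-Complex.I) by norm_num,
    aux_real_mul_cpow 2 two_pos _ (neg_ne_zero.2 Complex.I_ne_zero),
    Complex.cpow_def_of_ne_zero (neg_ne_zero.2 Complex.I_ne_zero), Complex.log_neg_I]
  congr 2
  push_cast; ring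

lemma bint_asymp : ∃ C : ℝ, 0 < C ∧ ∀ l : ℝ, 1 ≤ l →
    |bint l + 3 * √2 * √π * (l ^ (-(5/2) : ℝ) * Real.cos (l - π / 4))| ≤ C * l ^ (-(7/2) : ℝ) := by
  have hG : Real.Gamma (5/2) = 3 / 4 * √π := by
    have := Real.Gamma_nat_add_half 2
    norm_num [Nat.doubleFactorial] at this
    rw [this]; ring
  have h2 : (2:ℝ) ^ (3/2 : ℝ) = 2 * √2 := by
    rw [show (3/2 : ℝ) = 1 + 1/2 by norm_num, Real.rpow_add two_pos, Real.rpow_one,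
      Real.sqrt_eq_rpow]
  set K := ((3/2) * Real.Gamma (9/2) + 3 * Real.Gamma (7/2)) with hK
  have hKpos : 0 < K := by
    have := Real.Gamma_pos_of_pos (show (0:ℝ) < 9/2 by norm_num)
    have := Real.Gamma_pos_of_pos (show (0:ℝ) < 7/2 by norm_num)
    positivity
  refine ⟨2 * K, by positivity, fun l hl => ?_⟩
  have a1 := vfun_asymp (2 * Complex.I) (by simp) (by simp) l hl
  have a2 := vfun_asymp (-(2 * Complex.I)) (by simp) (by simp) l hl
  rw [← hK] at a1 a2
  set V1 := ∫ y in Set.Ioi (0:ℝ), vfun (2 * Complex.I) l y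
  set V2 := ∫ y in Set.Ioi (0:ℝ), vfun (-(2 * Complex.I)) l y
  set m : ℝ := l ^ (-(5/2) : ℝ) * Real.Gamma (5/2) with hm
  have hE1 : ‖Complex.exp (-(Complex.I * l))‖ = 1 := by
    rw [show -(Complex.I * l) = ((-l : ℝ) : ℂ) * Complex.I by push_cast; ring,
      Complex.norm_exp_ofReal_mul_I]
  have hE2 : ‖Complex.exp (Complex.I * l)‖ = 1 := by
    rw [show (Complex.I * l) = ((l : ℝ) : ℂ) * Complex.I by ring,
      Complex.norm_exp_ofReal_mul_I]
  have main : (Complex.I * Complex.exp (-(Complex.I * l)) * ((2 * Complex.I) ^ ((3/2 : ℝ) : ℂ) * (m:ℂ))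
      - Complex.I * Complex.exp (Complex.I * l) * ((-(2 * Complex.I)) ^ ((3/2 : ℝ) : ℂ) * (m:ℂ))).re
      = - (3 * √2 * √π * (l ^ (-(5/2) : ℝ) * Real.cos (l - π / 4))) := by
    rw [two_I_cpow, neg_two_I_cpow]
    have ee : Complex.I * Complex.exp (-(Complex.I * l)) *
          (((2 ^ (3/2 : ℝ) : ℝ) : ℂ) * Complex.exp ((3 * π / 4 : ℝ) * Complex.I) * (m:ℂ))
        - Complex.I * Complex.exp (Complex.I * l) *
          (((2 ^ (3/2 : ℝ) : ℝ) : ℂ) * Complex.exp (-((3 * π / 4 : ℝ) * Complex.I)) * (m:ℂ))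
        = ((2 ^ (3/2 : ℝ) * m : ℝ) : ℂ) * (Complex.I *
          (Complex.exp (((3 * π / 4 - l : ℝ) : ℂ) * Complex.I) -
            Complex.exp (((l - 3 * π / 4 : ℝ) : ℂ) * Complex.I))) := by
      rw [show ((3 * π / 4 - l : ℝ) : ℂ) * Complex.I =
          -(Complex.I * l) + (3 * π / 4 : ℝ) * Complex.I by push_cast; ring,
        show ((l - 3 * π / 4 : ℝ) : ℂ) * Complex.I =
          (Complex.I * l) + -((3 * π / 4 : ℝ) * Complex.I) by push_cast; ring,
        Complex.exp_add, Complex.exp_add]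
      push_cast; ring
    rw [ee, Complex.re_ofReal_mul, Complex.I_mul_re, Complex.sub_im, Complex.exp_ofReal_mul_I_im,
      Complex.exp_ofReal_mul_I_im, h2, hm, hG]
    have s1 : Real.sin (3 * π / 4 - l) = Real.cos (l - π / 4) := by
      rw [← Real.cos_pi_div_two_sub]; congr 1; ring
    have s2 : Real.sin (l - 3 * π / 4) = - Real.cos (l - π / 4) := by
      rw [← s1, ← Real.sin_neg]; congr 1; ring
    rw [s1, s2]; ring
  rw [bint_eq, rfun_eq l (by linarith)]
  have : (Complex.I * Complex.exp (-(Complex.I * l)) * V1 -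
      Complex.I * Complex.exp (Complex.I * l) * V2).re +
      3 * √2 * √π * (l ^ (-(5/2) : ℝ) * Real.cos (l - π / 4)) =
      (Complex.I * Complex.exp (-(Complex.I * l)) * (V1 - (2 * Complex.I) ^ ((3/2 : ℝ) : ℂ) * (m:ℂ))
      - Complex.I * Complex.exp (Complex.I * l) *
        (V2 - (-(2 * Complex.I)) ^ ((3/2 : ℝ) : ℂ) * (m:ℂ))).re := by
    have hmain2 := congrArg Neg.neg main
    rw [neg_neg] at hmain2
    rw [← hmain2, ← sub_eq_add_neg, ← Complex.sub_re]
    congr 1; ring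
  rw [this]
  refine (Complex.abs_re_le_norm _).trans ((norm_sub_le _ _).trans ?_)
  rw [norm_mul, norm_mul, norm_mul, norm_mul, hE1, hE2, Complex.norm_I]
  linarith

/-! ### Part 2: the Fourier transform of the truncated paraboloid -/

/-- the truncated paraboloid -/
noncomputable def dfun (R x y : ℝ) : ℝ := max 0 (R - 4 * π ^ 2 * (x ^ 2 + y ^ 2))

lemma dfun_continuous (R : ℝ) : Continuous fun p : ℝ × ℝ => dfun R p.1 p.2 := by
  unfold dfun; fun_prop

lemma one_le_four_pi_sq : 1 ≤ 4 * π ^ 2 := by nlinarith [Real.pi_gt_three]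

lemma dfun_eq_zero_left (R x y : ℝ) (hR : 0 ≤ R) (hx : √R < |x|) : dfun R x y = 0 := by
  have h1 : R < x ^ 2 := by
    rw [← sq_abs, ← Real.sqrt_lt_sqrt_iff hR, Real.sqrt_sq (abs_nonneg x)]; exact hx
  refine max_eq_left ?_
  nlinarith [one_le_four_pi_sq, sq_nonneg y, sq_nonneg x]

lemma dfun_comm (R x y : ℝ) : dfun R x y = dfun R y x := by
  unfold dfun; rw [add_comm (x ^ 2)]

lemma dfun_eq_zero_right (R x y : ℝ) (hR : 0 ≤ R) (hx : √R < |y|) : dfun R x y = 0 := by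
  rw [dfun_comm]; exact dfun_eq_zero_left R y x hR hx

/-- the exponential kernel -/
noncomputable def eker (t : ℝ) : ℂ := Complex.exp (((-2 * π * t : ℝ) : ℂ) * Complex.I)

lemma eker_continuous : Continuous eker := by unfold eker; fun_prop

lemma eker_add (s t : ℝ) : eker (s + t) = eker s * eker t := by
  unfold eker
  rw [← Complex.exp_add]; congr 1; push_cast; ring

/-- two-dimensional Fourier transform -/
noncomputable def fhat (R a b : ℝ) : ℂ :=
  ∫ p : ℝ × ℝ, eker (a * p.1 + b * p.2) * ((dfun R p.1 p.2 : ℝ) : ℂ)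

lemma fhat_integrable (R a b : ℝ) (hR : 0 ≤ R) :
    Integrable (fun p : ℝ × ℝ => eker (a * p.1 + b * p.2) * ((dfun R p.1 p.2 : ℝ) : ℂ)) := by
  apply Continuous.integrable_of_hasCompactSupport
  · refine Continuous.mul (eker_continuous.comp (by fun_prop))
      (Complex.continuous_ofReal.comp (dfun_continuous R))
  · refine HasCompactSupport.intro (K := Set.Icc (-√R) (√R) ×ˢ Set.Icc (-√R) (√R))
      (isCompact_Icc.prod isCompact_Icc) ?_
    intro p hp
    have : dfun R p.1 p.2 = 0 := by
      by_cases h1 : √R < |p.1|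
      · exact dfun_eq_zero_left R _ _ hR h1
      by_cases h2 : √R < |p.2|
      · exact dfun_eq_zero_right R _ _ hR h2
      exact absurd ⟨abs_le.1 (not_lt.1 h1), abs_le.1 (not_lt.1 h2)⟩ hp
    simp [this]

open FourierTransform in
lemma fhat_eq_fourier (R a b : ℝ) :
    fhat R a b = 𝓕 (fun v : ℂ => ((dfun R v.re v.im : ℝ) : ℂ)) (a + b * Complex.I) := by
  rw [Real.fourier_eq']
  unfold fhat
  rw [← Complex.volume_preserving_equiv_real_prod.integral_comp
    Complex.measurableEquivRealProd.measurableEmbedding]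
  refine integral_congr_ae (Filter.Eventually.of_forall fun v => ?_)
  simp only [Complex.measurableEquivRealProd_apply, smul_eq_mul, eker]
  congr 4
  rw [Complex.inner]
  simp

open FourierTransform in
lemma fhat_rotate (R a b : ℝ) : fhat R a b = fhat R (√(a ^ 2 + b ^ 2)) 0 := by
  rw [fhat_eq_fourier, fhat_eq_fourier]
  set w : ℂ := a + b * Complex.I with hw
  have hn : √(a ^ 2 + b ^ 2) = ‖w‖ := by
    rw [hw, Complex.norm_add_mul_I]
  rw [hn]
  simp only [Complex.ofReal_zero, zero_mul, add_zero]
  by_cases h0 : w = 0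
  · simp [h0]
  have hn0 : (‖w‖ : ℂ) ≠ 0 := by simpa using h0
  obtain ⟨u, hu⟩ : ∃ u : Circle, (u : ℂ) = w / ‖w‖ := by
    refine ⟨⟨w / ‖w‖, ?_⟩, rfl⟩
    rw [Submonoid.unitSphere, Submonoid.mem_mk]
    simp [h0]
  have := Real.fourier_comp_linearIsometry (rotation u)
    (fun v : ℂ => ((dfun R v.re v.im : ℝ) : ℂ)) (‖w‖ : ℂ)
  rw [rotation_apply, hu, div_mul_cancel₀ _ hn0] at this
  rw [← this]
  suffices hfun : (fun v : ℂ => ((dfun R v.re v.im : ℝ) : ℂ)) ∘ (rotation u) =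
      fun v : ℂ => ((dfun R v.re v.im : ℝ) : ℂ) by rw [hfun]
  funext v
  simp only [Function.comp_apply]
  have key : ∀ z : ℂ, z.re ^ 2 + z.im ^ 2 = ‖z‖ ^ 2 := by
    intro z; rw [← Complex.normSq_eq_norm_sq, Complex.normSq_apply]; ring
  unfold dfun
  rw [key, key, LinearIsometryEquiv.norm_map]

lemma parab_integral (b : ℝ) (hb : 0 ≤ b) :
    ∫ y : ℝ, max 0 (b ^ 2 - 4 * π ^ 2 * y ^ 2) = 2 / (3 * π) * b ^ 3 := by
  have hpi := Real.pi_pos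
  set c := b / (2 * π) with hc
  have hbc : b = 2 * π * c := by rw [hc]; field_simp
  have hc0 : 0 ≤ c := by positivity
  have h1 : ∫ y : ℝ, max 0 (b ^ 2 - 4 * π ^ 2 * y ^ 2) =
      ∫ y in Set.Ioc (-c) c, max 0 (b ^ 2 - 4 * π ^ 2 * y ^ 2) := by
    symm
    apply setIntegral_eq_integral_of_forall_compl_eq_zero
    intro y hy
    apply max_eq_left
    have : c ^ 2 ≤ y ^ 2 := by
      by_contra h
      have := abs_lt_of_sq_lt_sq (not_le.1 h) hc0
      rw [abs_lt] at this
      exact hy ⟨this.1, this.2.le⟩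
    rw [hbc]; nlinarith [sq_nonneg π]
  rw [h1, ← intervalIntegral.integral_of_le (by linarith)]
  have h2 : ∫ y in (-c)..c, max 0 (b ^ 2 - 4 * π ^ 2 * y ^ 2) =
      ∫ y in (-c)..c, (b ^ 2 - 4 * π ^ 2 * y ^ 2) := by
    apply intervalIntegral.integral_congr
    intro y hy
    rw [Set.uIcc_of_le (by linarith)] at hy
    apply max_eq_right
    have : y ^ 2 ≤ c ^ 2 := by nlinarith [hy.1, hy.2]
    rw [hbc]; nlinarith [sq_nonneg π]
  rw [h2, intervalIntegral.integral_sub (by simp)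
    (Continuous.intervalIntegrable (by fun_prop) _ _), intervalIntegral.integral_const_mul,
    integral_pow, intervalIntegral.integral_const, hbc]
  simp only [smul_eq_mul]
  field_simp
  norm_num
  ring

lemma inner_integral (R x : ℝ) :
    ∫ y : ℝ, dfun R x y = 2 / (3 * π) * (max 0 (R - 4 * π ^ 2 * x ^ 2)) ^ (3/2 : ℝ) := by
  unfold dfun
  by_cases h : 0 ≤ R - 4 * π ^ 2 * x ^ 2
  · rw [max_eq_right h]
    have h2 := parab_integral (√(R - 4 * π ^ 2 * x ^ 2)) (Real.sqrt_nonneg _)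
    have h3 : √(R - 4 * π ^ 2 * x ^ 2) ^ 3 = (R - 4 * π ^ 2 * x ^ 2) ^ (3/2 : ℝ) := by
      rw [Real.sqrt_eq_rpow, ← Real.rpow_natCast, ← Real.rpow_mul h]; norm_num
    rw [← h3, ← h2]
    congr 1
    funext y
    rw [Real.sq_sqrt h]
    congr 1; ring
  · rw [max_eq_left (not_le.1 h).le, Real.zero_rpow (by norm_num), mul_zero]
    refine integral_eq_zero_of_ae (Filter.Eventually.of_forall fun y => ?_)
    apply max_eq_left
    nlinarith [mul_nonneg (sq_nonneg π) (sq_nonneg y)]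

lemma eker_cos (t : ℝ) : eker t + eker (-t) = 2 * ((Real.cos (2 * π * t) : ℝ) : ℂ) := by
  unfold eker
  rw [Complex.ofReal_cos, Complex.two_cos]
  rw [add_comm]
  congr 2
  all_goals push_cast; ring

lemma eker_even_integral (h : ℝ → ℂ) (he : ∀ s, h (-s) = h s) (hc : Continuous h) (m : ℝ) :
    ∫ s in (-1:ℝ)..1, eker (m * s) * h s =
      ∫ s in (-1:ℝ)..1, ((Real.cos (2 * π * (m * s)) : ℝ) : ℂ) * h s := by
  have hi : ∀ m : ℝ, IntervalIntegrable (fun s => eker (m * s) * h s) volume (-1) 1 := fun m =>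
    Continuous.intervalIntegrable ((eker_continuous.comp (by fun_prop)).mul hc) _ _
  have h1 : ∫ s in (-1:ℝ)..1, eker (m * s) * h s = ∫ s in (-1:ℝ)..1, eker (-m * s) * h s := by
    have := intervalIntegral.integral_comp_neg (a := -1) (b := 1) (fun s => eker (m * s) * h s)
    rw [neg_neg] at this
    rw [← this]
    congr 1; funext s; rw [he]; congr 2; ring
  have h2 : 2 * ∫ s in (-1:ℝ)..1, eker (m * s) * h s =
      2 * ∫ s in (-1:ℝ)..1, ((Real.cos (2 * π * (m * s)) : ℝ) : ℂ) * h s := by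
    rw [two_mul]
    nth_rewrite 2 [h1]
    rw [← intervalIntegral.integral_add (hi m) (hi (-m)), ← intervalIntegral.integral_const_mul]
    congr 1; funext s
    rw [← add_mul, neg_mul, eker_cos]; ring
  exact mul_left_cancel₀ two_ne_zero h2

lemma fhat_eq (R a b : ℝ) (hR : 0 < R) :
    fhat R a b = ((R ^ 2 / (3 * π ^ 2) * bint (√R * √(a ^ 2 + b ^ 2)) : ℝ) : ℂ) := by
  have hpi := Real.pi_pos
  rw [fhat_rotate]
  set ρ := √(a ^ 2 + b ^ 2)
  have hsR : 0 < √R := Real.sqrt_pos.2 hR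
  have h1 : fhat R ρ 0 = ∫ x : ℝ, eker (ρ * x) *
      ((2 / (3 * π) * (max 0 (R - 4 * π ^ 2 * x ^ 2)) ^ (3/2 : ℝ) : ℝ) : ℂ) := by
    have hfint := fhat_integrable R ρ 0 hR.le
    unfold fhat
    rw [Measure.volume_eq_prod] at hfint ⊢
    rw [integral_prod _ hfint]
    congr 1; funext x
    simp only [zero_mul, add_zero]
    rw [integral_const_mul, integral_complex_ofReal, inner_integral]
  set c := √R / (2 * π) with hc
  have hc0 : 0 < c := by positivity
  have h2 := Measure.integral_comp_mul_left (fun x : ℝ => eker (ρ * x) *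
      ((2 / (3 * π) * (max 0 (R - 4 * π ^ 2 * x ^ 2)) ^ (3/2 : ℝ) : ℝ) : ℂ)) c
  rw [← h1, abs_of_pos (inv_pos.2 hc0)] at h2
  have hcp : Continuous fun x : ℝ => (max 0 (1 - x ^ 2)) ^ (3/2 : ℝ) :=
    Continuous.rpow_const (by fun_prop) (fun _ => Or.inr (by norm_num))
  have h3 : ∀ x : ℝ, eker (ρ * (c * x)) *
      ((2 / (3 * π) * (max 0 (R - 4 * π ^ 2 * (c * x) ^ 2)) ^ (3/2 : ℝ) : ℝ) : ℂ) =
      ((2 / (3 * π) * (R * √R) : ℝ) : ℂ) *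
      (eker (ρ * c * x) * (((max 0 (1 - x ^ 2)) ^ (3/2 : ℝ) : ℝ) : ℂ)) := by
    intro x
    have e1 : R - 4 * π ^ 2 * (c * x) ^ 2 = R * (1 - x ^ 2) := by
      have : (2 * π * c) ^ 2 = R := by
        rw [hc, mul_div_cancel₀ _ (by positivity), Real.sq_sqrt hR.le]
      linear_combination (-x ^ 2) * this
    have e2 : max 0 (R * (1 - x ^ 2)) = R * max 0 (1 - x ^ 2) := by
      rw [mul_max_of_nonneg _ _ hR.le, mul_zero]
    have e3 : R ^ (3/2 : ℝ) = R * √R := by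
      rw [show (3/2 : ℝ) = 1 + 1/2 by norm_num, Real.rpow_add hR, Real.rpow_one,
        Real.sqrt_eq_rpow]
    rw [e1, e2, Real.mul_rpow hR.le (le_max_left _ _), e3, ← mul_assoc ρ]
    push_cast; ring
  simp only [h3] at h2
  rw [integral_const_mul] at h2
  have h4 : ∫ x : ℝ, eker (ρ * c * x) * (((max 0 (1 - x ^ 2)) ^ (3/2 : ℝ) : ℝ) : ℂ) =
      ∫ x in (-1:ℝ)..1, eker (ρ * c * x) * (((max 0 (1 - x ^ 2)) ^ (3/2 : ℝ) : ℝ) : ℂ) := by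
    rw [intervalIntegral.integral_of_le (by norm_num)]
    symm
    apply setIntegral_eq_integral_of_forall_compl_eq_zero
    intro x hx
    have : max 0 (1 - x ^ 2) = 0 := by
      apply max_eq_left
      by_contra h
      have := abs_lt_of_sq_lt_sq (show x ^ 2 < 1 ^ 2 by linarith [not_le.1 h]) zero_le_one
      rw [abs_lt] at this
      exact hx ⟨this.1, this.2.le⟩
    rw [this, Real.zero_rpow (by norm_num)]; simp
  rw [h4, eker_even_integral (fun x : ℝ => (((max 0 (1 - x ^ 2)) ^ (3/2 : ℝ) : ℝ) : ℂ))
    (by intro s; simp) (Complex.continuous_ofReal.comp hcp)] at h2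
  have h5 : ∫ x in (-1:ℝ)..1, ((Real.cos (2 * π * (ρ * c * x)) : ℝ) : ℂ) *
      (((max 0 (1 - x ^ 2)) ^ (3/2 : ℝ) : ℝ) : ℂ) = ((bint (√R * ρ) : ℝ) : ℂ) := by
    unfold bint
    rw [← intervalIntegral.integral_ofReal]
    apply intervalIntegral.integral_congr
    intro x hx
    rw [Set.uIcc_of_le (by norm_num)] at hx
    simp only
    rw [max_eq_right (by nlinarith [hx.1, hx.2]),
      show 2 * π * (ρ * c * x) = √R * ρ * x by rw [hc]; field_simp]
    push_cast; ring
  rw [h5] at h2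
  have h6 : fhat R ρ 0 = (c : ℂ) * ((c⁻¹ : ℝ) • fhat R ρ 0) := by
    rw [Complex.real_smul, ← mul_assoc, ← Complex.ofReal_mul, mul_inv_cancel₀ hc0.ne']; simp
  rw [h6, ← h2]
  norm_cast
  rw [hc]
  have : √R * √R = R := Real.mul_self_sqrt hR.le
  field_simp
  linear_combination (bint (√R * ρ)) * this

/-! ### Part 3: Poisson summation -/

lemma znorm_nonneg (n : ℤ × ℤ) : 0 ≤ znorm n := Real.sqrt_nonneg _

open FourierTransform in
lemma poisson_cs (g : ℝ → ℂ) (hc : Continuous g) (K : ℝ) (hK : ∀ x, K < |x| → g x = 0)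
    (hs : Summable fun n : ℤ => 𝓕 g n) : ∑' n : ℤ, g n = ∑' n : ℤ, 𝓕 g n := by
  have hO : Asymptotics.IsBigO (Filter.cocompact ℝ) g fun x : ℝ => |x| ^ (-(2:ℝ)) := by
    have : g =ᶠ[Filter.cocompact ℝ] fun _ => (0:ℂ) := by
      have h1 : (Set.Icc (-K) K)ᶜ ∈ Filter.cocompact ℝ := isCompact_Icc.compl_mem_cocompact
      filter_upwards [h1] with x hx
      apply hK
      by_contra h
      exact hx (abs_le.1 (not_lt.1 h))
    exact this.trans_isBigO (Asymptotics.isBigO_zero _ _)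
  have := Real.tsum_eq_tsum_fourier_of_rpow_decay_of_summable hc (b := 2) (by norm_num) hO hs 0
  simpa using this

/-- partial Fourier transform -/
noncomputable def psi (R a y : ℝ) : ℂ := ∫ x : ℝ, eker (a * x) * ((dfun R x y : ℝ) : ℂ)

lemma psi_zero (R a y : ℝ) (hR : 0 ≤ R) (hy : √R < |y|) : psi R a y = 0 := by
  unfold psi
  simp [dfun_eq_zero_right R _ y hR hy]

lemma psi_continuous (R a : ℝ) (hR : 0 ≤ R) : Continuous (psi R a) := by
  have h : psi R a = fun y => ∫ x in Set.Icc (-√R) (√R), eker (a * x) * ((dfun R x y : ℝ) : ℂ) := by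
    funext y
    symm
    apply setIntegral_eq_integral_of_forall_compl_eq_zero
    intro x hx
    rw [dfun_eq_zero_left R x y hR]
    · simp
    · by_contra h
      exact hx (abs_le.1 (not_lt.1 h))
  rw [h]
  refine continuous_parametric_integral_of_continuous
    (f := fun y x : ℝ => eker (a * x) * ((dfun R x y : ℝ) : ℂ)) ?_ isCompact_Icc
  refine Continuous.mul (eker_continuous.comp (by fun_prop)) (Complex.continuous_ofReal.comp ?_)
  unfold dfun; fun_prop

open FourierTransform in
lemma fourier_psi (R a b : ℝ) (hR : 0 ≤ R) : 𝓕 (psi R a) b = fhat R a b := by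
  rw [Real.fourier_real_eq_integral_exp_smul]
  have hfint := fhat_integrable R a b hR
  unfold fhat
  rw [Measure.volume_eq_prod] at hfint ⊢
  rw [integral_prod_symm _ hfint]
  congr 1; funext y
  simp only [psi, smul_eq_mul]
  rw [← integral_const_mul]
  congr 1; funext x
  rw [eker_add, show b * y = y * b by ring]
  simp only [eker]
  rw [show -2 * π * (y * b) = -2 * π * y * b by ring]
  ring

lemma poisson_two (R : ℝ) (hR : 0 ≤ R)
    (hs : Summable fun p : ℤ × ℤ => fhat R p.1 p.2) :
    ∑' m : ℤ, ∑' n : ℤ, ((dfun R m n : ℝ) : ℂ) = ∑' p : ℤ × ℤ, fhat R p.1 p.2 := by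
  obtain ⟨K, hK⟩ := exists_nat_gt (√R)
  have hout : ∀ n : ℤ, n ∉ Finset.Icc (-(K:ℤ)) K → √R < |(n:ℝ)| := by
    intro n hn
    refine hK.trans_le ?_
    by_contra h
    apply hn
    rw [Finset.mem_Icc]
    have := abs_lt.1 (not_le.1 h)
    constructor
    · have := this.1; exact_mod_cast this.le
    · have := this.2; exact_mod_cast this.le
  -- inner sums
  have hin : ∀ x : ℝ, ∑' n : ℤ, ((dfun R x n : ℝ) : ℂ) =
      ∑ n ∈ Finset.Icc (-(K:ℤ)) K, ((dfun R x n : ℝ) : ℂ) := fun x =>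
    tsum_eq_sum fun n hn => by simp [dfun_eq_zero_right R x n hR (hout n hn)]
  set Phi : ℝ → ℂ := fun x => ∑ n ∈ Finset.Icc (-(K:ℤ)) K, ((dfun R x n : ℝ) : ℂ) with hPhi
  have hPc : Continuous Phi := by
    refine continuous_finsetSum _ fun n _ => Complex.continuous_ofReal.comp ?_
    unfold dfun; fun_prop
  have hP0 : ∀ x, √R < |x| → Phi x = 0 := fun x hx =>
    Finset.sum_eq_zero fun n _ => by simp [dfun_eq_zero_left R x n hR hx]
  have hPF : ∀ a : ℤ, FourierTransform.fourier Phi (a : ℝ) = ∑' k : ℤ, fhat R a k := by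
    intro a
    have hsa : Summable fun k : ℤ => fhat R a k := hs.prod_factor a
    have h1 := poisson_cs (psi R a) (psi_continuous R a hR) (√R)
      (fun y hy => psi_zero R a y hR hy) (by simpa only [fourier_psi R a _ hR] using hsa)
    simp only [fourier_psi R a _ hR] at h1
    rw [← h1, Real.fourier_real_eq_integral_exp_smul]
    rw [tsum_eq_sum (s := Finset.Icc (-(K:ℤ)) K)
      fun n hn => psi_zero R a n hR (hout n hn)]
    simp only [hPhi, smul_eq_mul, Finset.mul_sum]
    rw [integral_finsetSum]
    · refine Finset.sum_congr rfl fun n _ => ?_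
      unfold psi
      congr 1; funext x
      simp only [eker]
      rw [show -2 * π * (a * x) = -2 * π * x * a by ring]
    · intro n _
      apply Continuous.integrable_of_hasCompactSupport
      · refine Continuous.mul (by fun_prop) (Complex.continuous_ofReal.comp ?_)
        unfold dfun; fun_prop
      · refine HasCompactSupport.intro (K := Set.Icc (-√R) (√R)) isCompact_Icc ?_
        intro x hx
        rw [dfun_eq_zero_left R x n hR]
        · simp
        · by_contra h
          exact hx (abs_le.1 (not_lt.1 h))
  have h2 := poisson_cs Phi hPc (√R) hP0 (by simpa only [hPF] using hs.prod)
  simp only [hPF] at h2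
  rw [hs.tsum_prod, ← h2]
  exact tsum_congr fun m => hin m

lemma znorm_one_le (n : ℤ × ℤ) (hn : n ≠ 0) : 1 ≤ znorm n := by
  unfold znorm
  rw [Real.one_le_sqrt]
  have : (1:ℤ) ≤ n.1 ^ 2 + n.2 ^ 2 := by
    by_contra h
    apply hn
    have h1 : n.1 ^ 2 = 0 := by nlinarith [sq_nonneg n.1, sq_nonneg n.2]
    have h2 : n.2 ^ 2 = 0 := by nlinarith [sq_nonneg n.1, sq_nonneg n.2]
    exact Prod.ext (by simpa using h1) (by simpa using h2)
  exact_mod_cast this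

lemma znorm_summable (k : ℝ) (hk : 2 < k) : Summable fun n : ℤ × ℤ => znorm n ^ (-k) := by
  have h := EisensteinSeries.summable_one_div_norm_rpow hk
  rw [← (finTwoArrowEquiv _).symm.summable_iff] at h
  refine Summable.of_nonneg_of_le (fun n => Real.rpow_nonneg (Real.sqrt_nonneg _) _) ?_ h
  intro n
  simp only [Function.comp_apply]
  by_cases hn : n = 0
  · subst hn
    have : znorm 0 = 0 := by simp [znorm]
    rw [this, Real.zero_rpow (by linarith)]
    positivity
  have hpos : 0 < ‖(finTwoArrowEquiv ℤ).symm n‖ := by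
    rw [norm_pos_iff]
    intro h0
    apply hn
    have h1 := congrFun h0 0
    have h2 := congrFun h0 1
    exact Prod.ext (by simpa using h1) (by simpa using h2)
  refine Real.rpow_le_rpow_of_nonpos hpos ?_ (by linarith)
  rw [pi_norm_le_iff_of_nonneg (znorm_nonneg n)]
  intro i
  unfold znorm
  apply Real.le_sqrt_of_sq_le
  fin_cases i
  · simp [Int.norm_eq_abs]; positivity
  · simp [Int.norm_eq_abs]; positivity

lemma fhat_lattice (R : ℝ) (hR : 0 < R) (n : ℤ × ℤ) :
    fhat R n.1 n.2 = ((R ^ 2 / (3 * π ^ 2) * bint (√R * znorm n) : ℝ) : ℂ) := by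
  rw [fhat_eq R _ _ hR]; rfl

lemma bint_summable (R : ℝ) (hR : 1 ≤ R) : Summable fun n : ℤ × ℤ => bint (√R * znorm n) := by
  obtain ⟨C, hC, h⟩ := bint_asymp
  have hsum := (znorm_summable (5/2) (by norm_num)).mul_left (3 * √2 * √π + C)
  refine Summable.of_norm_bounded_eventually hsum ?_
  have hfin : ({0} : Set (ℤ × ℤ))ᶜ ∈ Filter.cofinite := (Set.finite_singleton 0).compl_mem_cofinite
  filter_upwards [hfin] with n hn
  have hz := znorm_one_le n hn
  have hl : znorm n ≤ √R * znorm n := by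
    have := Real.one_le_sqrt.2 hR
    nlinarith
  set l := √R * znorm n
  have hl1 : 1 ≤ l := hz.trans hl
  have h1 := h l hl1
  have h75 : l ^ (-(7/2) : ℝ) ≤ l ^ (-(5/2) : ℝ) :=
    Real.rpow_le_rpow_of_exponent_le hl1 (by norm_num)
  have h55 : l ^ (-(5/2) : ℝ) ≤ znorm n ^ (-(5/2) : ℝ) :=
    Real.rpow_le_rpow_of_nonpos (by linarith) hl (by norm_num)
  have hl0 : 0 ≤ l ^ (-(5/2) : ℝ) := Real.rpow_nonneg (by linarith) _
  have h2 : |3 * √2 * √π * (l ^ (-(5/2) : ℝ) * Real.cos (l - π / 4))| ≤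
      3 * √2 * √π * l ^ (-(5/2) : ℝ) := by
    rw [abs_mul, abs_of_nonneg (show (0:ℝ) ≤ 3 * √2 * √π by positivity), abs_mul,
      abs_of_nonneg hl0]
    gcongr
    exact mul_le_of_le_one_right hl0 (Real.abs_cos_le_one _)
  rw [Real.norm_eq_abs]
  calc |bint l| ≤ |bint l + 3 * √2 * √π * (l ^ (-(5/2) : ℝ) * Real.cos (l - π / 4))| +
        |3 * √2 * √π * (l ^ (-(5/2) : ℝ) * Real.cos (l - π / 4))| := by
        have := abs_sub (bint l + 3 * √2 * √π * (l ^ (-(5/2) : ℝ) * Real.cos (l - π / 4)))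
          (3 * √2 * √π * (l ^ (-(5/2) : ℝ) * Real.cos (l - π / 4)))
        rwa [add_sub_cancel_right] at this
    _ ≤ C * l ^ (-(5/2) : ℝ) + 3 * √2 * √π * l ^ (-(5/2) : ℝ) := by
        have := mul_le_mul_of_nonneg_left h75 hC.le
        linarith
    _ = (3 * √2 * √π + C) * l ^ (-(5/2) : ℝ) := by ring
    _ ≤ _ := by gcongr

lemma poisson_final (R : ℝ) (hR : 1 ≤ R) :
    ∑' m : ℤ, ∑' n : ℤ, dfun R m n = R ^ 2 / (3 * π ^ 2) * ∑' n : ℤ × ℤ, bint (√R * znorm n) := by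
  have hR0 : 0 < R := by linarith
  have hb := (bint_summable R hR).mul_left (R ^ 2 / (3 * π ^ 2))
  have h := poisson_two R hR0.le (by
    simp only [fhat_lattice R hR0]
    exact Complex.ofRealCLM.summable hb)
  simp only [fhat_lattice R hR0, ← Complex.ofReal_tsum] at h
  rw [Complex.ofReal_inj.1 h, tsum_mul_left]

/-! ### Part 4: the integrated counting function -/

lemma step_integral (R c : ℝ) (hR : 0 ≤ R) (hc : 0 ≤ c) :
    IntervalIntegrable (fun t : ℝ => if c ≤ t then (1:ℝ) else 0) volume 0 R ∧
    ∫ t in (0:ℝ)..R, (if c ≤ t then (1:ℝ) else 0) = max 0 (R - c) := by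
  have he : (fun t : ℝ => if c ≤ t then (1:ℝ) else 0) = (Set.Ici c).indicator fun _ => (1:ℝ) := by
    funext t; simp [Set.indicator_apply]
  rw [he]
  constructor
  · rw [intervalIntegrable_iff_integrableOn_Ioc_of_le hR]
    exact (integrable_const (1:ℝ)).indicator measurableSet_Ici
  · rw [intervalIntegral.integral_of_le hR, integral_congr_ae
      (g := (Set.Ioi c).indicator fun _ => (1:ℝ))
      (ae_restrict_of_ae (indicator_ae_eq_of_ae_eq_set Ioi_ae_eq_Ici.symm)),
      setIntegral_indicator measurableSet_Ioi, Set.Ioc_inter_Ioi, max_eq_right hc]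
    simp [max_comm]

lemma Nlat_integral (R : ℝ) (hR : 0 < R) :
    IntervalIntegrable (fun t => (Nlat t : ℝ)) volume 0 R ∧
    ∫ t in (0:ℝ)..R, (Nlat t : ℝ) = ∑' m : ℤ, ∑' n : ℤ, dfun R m n := by
  have hpi := Real.pi_pos
  obtain ⟨K, hK⟩ := exists_nat_gt (√R)
  have hout : ∀ n : ℤ, n ∉ Finset.Icc (-(K:ℤ)) K → √R < |(n:ℝ)| := by
    intro n hn
    refine hK.trans_le ?_
    by_contra h
    apply hn
    rw [Finset.mem_Icc]
    have := abs_lt.1 (not_le.1 h)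
    constructor
    · have := this.1; exact_mod_cast this.le
    · have := this.2; exact_mod_cast this.le
  have hrhs : ∑' m : ℤ, ∑' n : ℤ, dfun R m n =
      ∑ p ∈ Finset.Icc (-(K:ℤ)) K ×ˢ Finset.Icc (-(K:ℤ)) K, dfun R p.1 p.2 := by
    rw [Finset.sum_product, tsum_eq_sum (s := Finset.Icc (-(K:ℤ)) K)]
    · refine Finset.sum_congr rfl fun m _ => tsum_eq_sum fun n hn => ?_
      exact dfun_eq_zero_right R m n hR.le (hout n hn)
    · intro m hm
      simp [dfun_eq_zero_left R m _ hR.le (hout m hm)]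
  set S := Finset.Icc (-(K:ℤ)) K ×ˢ Finset.Icc (-(K:ℤ)) K with hS
  have hiff : ∀ t : ℝ, 0 ≤ t → ∀ n : ℤ × ℤ, znorm n ≤ √t / (2 * π) ↔
      4 * π ^ 2 * ((n.1:ℝ) ^ 2 + (n.2:ℝ) ^ 2) ≤ t := by
    intro t ht n
    have hq : (0:ℝ) ≤ (n.1:ℝ) ^ 2 + (n.2:ℝ) ^ 2 := by positivity
    unfold znorm
    rw [le_div_iff₀ (by positivity), Real.le_sqrt (by positivity) ht, mul_pow, Real.sq_sqrt hq]
    rw [show ((n.1:ℝ) ^ 2 + (n.2:ℝ) ^ 2) * (2 * π) ^ 2 =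
      4 * π ^ 2 * ((n.1:ℝ) ^ 2 + (n.2:ℝ) ^ 2) by ring]
  have hN : ∀ t ∈ Set.uIcc 0 R, (Nlat t : ℝ) =
      ∑ p ∈ S, (if 4 * π ^ 2 * ((p.1:ℝ) ^ 2 + (p.2:ℝ) ^ 2) ≤ t then (1:ℝ) else 0) := by
    intro t ht
    rw [Set.uIcc_of_le hR.le] at ht
    rw [Finset.sum_boole]
    unfold Nlat
    rw [← Set.ncard_coe_finset]
    congr 2
    ext n
    simp only [Finset.coe_filter, Set.mem_setOf_eq]
    rw [hiff t ht.1]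
    refine ⟨fun h => ⟨?_, h⟩, fun h => h.2⟩
    have h' : 4 * π ^ 2 * ((n.1:ℝ) ^ 2 + (n.2:ℝ) ^ 2) ≤ R := h.trans ht.2
    have hbd : (n.1:ℝ) ^ 2 + (n.2:ℝ) ^ 2 ≤ R := by
      nlinarith [one_le_four_pi_sq, sq_nonneg (n.1:ℝ), sq_nonneg (n.2:ℝ)]
    rw [hS, Finset.mem_product]
    constructor
    · by_contra hcon
      have := hout _ hcon
      have h2 := Real.abs_le_sqrt (show (n.1:ℝ) ^ 2 ≤ R by nlinarith [sq_nonneg (n.2:ℝ)])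
      linarith
    · by_contra hcon
      have := hout _ hcon
      have h2 := Real.abs_le_sqrt (show (n.2:ℝ) ^ 2 ≤ R by nlinarith [sq_nonneg (n.1:ℝ)])
      linarith
  have hstep := fun p : ℤ × ℤ => step_integral R (4 * π ^ 2 * ((p.1:ℝ) ^ 2 + (p.2:ℝ) ^ 2)) hR.le
    (by positivity)
  have hsumint : IntervalIntegrable (fun t : ℝ => ∑ p ∈ S,
      (if 4 * π ^ 2 * ((p.1:ℝ) ^ 2 + (p.2:ℝ) ^ 2) ≤ t then (1:ℝ) else 0)) volume 0 R := by
    have := IntervalIntegrable.sum S (fun p _ => (hstep p).1)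
    refine this.congr ?_
    intro t _
    simp
  constructor
  · refine hsumint.congr fun t ht => (hN t (Set.uIoc_subset_uIcc ht)).symm
  · rw [intervalIntegral.integral_congr hN, intervalIntegral.integral_finsetSum
      (fun p _ => (hstep p).1), hrhs]
    exact Finset.sum_congr rfl fun p _ => (hstep p).2

lemma bint_zero : bint 0 = 3 * π / 8 := by
  have hd : ∀ s ∈ Set.uIcc (-1:ℝ) 1, HasDerivAt (fun s : ℝ => s * (1 - s ^ 2) ^ (3/2 : ℝ))
      (1 * (1 - s ^ 2) ^ (3/2 : ℝ) + s * (-(2 * s) * (3/2) * (1 - s ^ 2) ^ ((3/2 : ℝ) - 1))) s := by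
    intro s _
    have h1 : HasDerivAt (fun s : ℝ => 1 - s ^ 2) (-(2 * s)) s := by
      simpa using (hasDerivAt_pow 2 s).const_sub 1
    exact (hasDerivAt_id s).mul (h1.rpow_const (Or.inr (by norm_num)))
  have hc1 : Continuous fun s : ℝ => (1 - s ^ 2) ^ (3/2 : ℝ) :=
    Continuous.rpow_const (by fun_prop) (fun _ => Or.inr (by norm_num))
  have hc2 : Continuous fun s : ℝ => (1 - s ^ 2) ^ ((3/2 : ℝ) - 1) :=
    Continuous.rpow_const (by fun_prop) (fun _ => Or.inr (by norm_num))
  have h := intervalIntegral.integral_eq_sub_of_hasDerivAt hd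
    (Continuous.intervalIntegrable (by fun_prop) _ _)
  have he : ∫ s in (-1:ℝ)..1, (1 * (1 - s ^ 2) ^ (3/2 : ℝ) +
      s * (-(2 * s) * (3/2) * (1 - s ^ 2) ^ ((3/2 : ℝ) - 1))) =
      ∫ s in (-1:ℝ)..1, (4 * (1 - s ^ 2) ^ (3/2 : ℝ) - 3 * √(1 - s ^ 2)) := by
    apply intervalIntegral.integral_congr
    intro s hs
    rw [Set.uIcc_of_le (by norm_num)] at hs
    have h0 : 0 ≤ 1 - s ^ 2 := by nlinarith [hs.1, hs.2]
    have h32 : (1 - s ^ 2) ^ (3/2 : ℝ) = (1 - s ^ 2) * √(1 - s ^ 2) := by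
      rw [Real.sqrt_eq_rpow]
      rw [show (3/2 : ℝ) = 1 + 1/2 by norm_num, Real.rpow_add_of_nonneg h0 (by norm_num)
        (by norm_num), Real.rpow_one]
    have h12 : (1 - s ^ 2) ^ ((3/2 : ℝ) - 1) = √(1 - s ^ 2) := by
      rw [Real.sqrt_eq_rpow]; norm_num
    simp only
    rw [h32, h12]; ring
  rw [he, intervalIntegral.integral_sub (Continuous.intervalIntegrable (by fun_prop) _ _)
    (Continuous.intervalIntegrable (by fun_prop) _ _), intervalIntegral.integral_const_mul,
    intervalIntegral.integral_const_mul, integral_sqrt_one_sub_sq] at h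
  have hb : bint 0 = ∫ s in (-1:ℝ)..1, (1 - s ^ 2) ^ (3/2 : ℝ) := by
    unfold bint; simp
  rw [← hb] at h
  norm_num at h
  linarith

lemma Alat_eq (R : ℝ) (hR : 1 ≤ R) :
    Alat R = R / (3 * π ^ 2) * ∑' n : {n : ℤ × ℤ // n ≠ 0}, bint (√R * znorm n.1) := by
  have hR0 : 0 < R := by linarith
  have hpi := Real.pi_pos
  obtain ⟨hi, hN⟩ := Nlat_integral R hR0
  unfold Alat Dlat
  rw [intervalIntegral.integral_sub hi (Continuous.intervalIntegrable (by fun_prop) _ _), hN,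
    poisson_final R hR, intervalIntegral.integral_div, integral_id]
  have hs := bint_summable R hR
  have h1 : ∑' n : ℤ × ℤ, bint (√R * znorm n) =
      bint 0 + ∑' n : {n : ℤ × ℤ // n ≠ 0}, bint (√R * znorm n.1) := by
    rw [← hs.tsum_subtype_add_tsum_subtype_compl {0}]
    congr 1
    simp [znorm]
  rw [h1, bint_zero]
  field_simp
  ring

/-! ### Part 5: conclusion -/

lemma sqrt_mul_rpow (R z p : ℝ) (hR : 0 < R) (hz : 0 ≤ z) :
    (√R * z) ^ p = R ^ (p / 2) * z ^ p := by
  rw [Real.mul_rpow (Real.sqrt_nonneg _) hz, Real.sqrt_eq_rpow, ← Real.rpow_mul hR.le]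
  congr 2; ring

/-- `A(R) = g(√R)·R^{-1/4} + O(R^{-3/4})` as `R → ∞`. -/
theorem average_asymptotics :
    ∃ C : ℝ, 0 < C ∧ ∀ R : ℝ, 1 ≤ R →
      |Alat R - gfun (Real.sqrt R) * R ^ (-(1/4) : ℝ)| ≤ C * R ^ (-(3/4) : ℝ) := by
  obtain ⟨C, hC, hb⟩ := bint_asymp
  have hpi := Real.pi_pos
  have hz7 : Summable fun n : {n : ℤ × ℤ // n ≠ 0} => znorm n.1 ^ (-(7/2) : ℝ) :=
    (znorm_summable (7/2) (by norm_num)).subtype {n | n ≠ 0}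
  have hz5 : Summable fun n : {n : ℤ × ℤ // n ≠ 0} => znorm n.1 ^ (-(5/2) : ℝ) :=
    (znorm_summable (5/2) (by norm_num)).subtype {n | n ≠ 0}
  set T := ∑' n : {n : ℤ × ℤ // n ≠ 0}, znorm n.1 ^ (-(7/2) : ℝ) with hT
  have hT0 : 0 ≤ T := tsum_nonneg fun n => Real.rpow_nonneg (Real.sqrt_nonneg _) _
  refine ⟨C / (3 * π ^ 2) * (T + 1), by positivity, fun R hR => ?_⟩
  have hR0 : 0 < R := by linarith
  have hs1 : Summable fun n : {n : ℤ × ℤ // n ≠ 0} => bint (√R * znorm n.1) :=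
    (bint_summable R hR).subtype {n | n ≠ 0}
  have hs2 : Summable fun n : {n : ℤ × ℤ // n ≠ 0} =>
      znorm n.1 ^ (-(5/2) : ℝ) * Real.cos (znorm n.1 * √R - π/4) := by
    refine Summable.of_norm_bounded hz5 fun n => ?_
    have h0 : 0 ≤ znorm n.1 ^ (-(5/2) : ℝ) := Real.rpow_nonneg (Real.sqrt_nonneg _) _
    rw [Real.norm_eq_abs, abs_mul, abs_of_nonneg h0]
    exact mul_le_of_le_one_right h0 (Real.abs_cos_le_one _)
  have hpi32 : π ^ ((3:ℝ)/2) = π * √π := by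
    rw [show ((3:ℝ)/2) = 1 + 1/2 by norm_num, Real.rpow_add hpi, Real.rpow_one, Real.sqrt_eq_rpow]
  have hRR : R * R ^ (-(5/2) / 2 : ℝ) = R ^ (-(1/4) : ℝ) := by
    nth_rewrite 1 [← Real.rpow_one R]
    rw [← Real.rpow_add hR0]; norm_num
  have hRR7 : R * R ^ (-(7/2) / 2 : ℝ) = R ^ (-(3/4) : ℝ) := by
    nth_rewrite 1 [← Real.rpow_one R]
    rw [← Real.rpow_add hR0]; norm_num
  have hterm : ∀ n : {n : ℤ × ℤ // n ≠ 0},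
      R / (3 * π ^ 2) * bint (√R * znorm n.1) +
        √2 / π ^ ((3:ℝ)/2) * R ^ (-(1/4) : ℝ) *
          (znorm n.1 ^ (-(5/2) : ℝ) * Real.cos (znorm n.1 * √R - π/4)) =
      R / (3 * π ^ 2) * (bint (√R * znorm n.1) + 3 * √2 * √π *
        ((√R * znorm n.1) ^ (-(5/2) : ℝ) * Real.cos (√R * znorm n.1 - π / 4))) := by
    intro n
    rw [sqrt_mul_rpow R _ _ hR0 (znorm_nonneg n.1), ← hRR, hpi32, mul_comm (znorm n.1) (√R)]
    have hsq : √π * √π = π := Real.mul_self_sqrt hpi.le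
    have hsp : 0 < √π := Real.sqrt_pos.2 hpi
    have e : √2 / (π * √π) = √2 * √π / π ^ 2 := by
      rw [div_eq_div_iff (by positivity) (by positivity)]
      linear_combination (-√2 * π) * hsq
    rw [e]
    field_simp
  have heq : Alat R - gfun (√R) * R ^ (-(1/4) : ℝ) =
      ∑' n : {n : ℤ × ℤ // n ≠ 0}, R / (3 * π ^ 2) * (bint (√R * znorm n.1) + 3 * √2 * √π *
        ((√R * znorm n.1) ^ (-(5/2) : ℝ) * Real.cos (√R * znorm n.1 - π / 4))) := by
    rw [← tsum_congr hterm, (hs1.mul_left _).tsum_add (hs2.mul_left _), tsum_mul_left,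
      tsum_mul_left, Alat_eq R hR]
    unfold gfun
    ring
  rw [heq]
  have hbound : ∀ n : {n : ℤ × ℤ // n ≠ 0},
      ‖R / (3 * π ^ 2) * (bint (√R * znorm n.1) + 3 * √2 * √π *
        ((√R * znorm n.1) ^ (-(5/2) : ℝ) * Real.cos (√R * znorm n.1 - π / 4)))‖ ≤
      C / (3 * π ^ 2) * R ^ (-(3/4) : ℝ) * znorm n.1 ^ (-(7/2) : ℝ) := by
    intro n
    have hz := znorm_one_le n.1 n.2
    have hl : 1 ≤ √R * znorm n.1 := by
      have := Real.one_le_sqrt.2 hR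
      nlinarith
    have h1 := hb _ hl
    rw [sqrt_mul_rpow R _ (-(7/2)) hR0 (znorm_nonneg n.1)] at h1
    rw [Real.norm_eq_abs, abs_mul, abs_of_nonneg (show 0 ≤ R / (3 * π ^ 2) by positivity)]
    refine (mul_le_mul_of_nonneg_left h1 (by positivity)).trans (le_of_eq ?_)
    rw [← hRR7]; ring
  have := tsum_of_norm_bounded (hz7.hasSum.mul_left (C / (3 * π ^ 2) * R ^ (-(3/4) : ℝ))) hbound
  rw [← hT, Real.norm_eq_abs] at this
  refine this.trans ?_
  have hp : 0 ≤ C / (3 * π ^ 2) * R ^ (-(3/4) : ℝ) := by positivity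
  nlinarith
end
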